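/- arXiv:2211.04174 — 4 statements merged into one kernel-verified Lean document; each statement's English description precedes it below -/
import Mathlib

section
/- Let n ≥ 1 and let X_1, …, X_n be i.i.d. real random variables with E[X_1] = 0, E[X_1^2] = 1, E[X_1^3] = γ and E[X_1^4] < ∞. Suppose X_1 has a Stein kernel τ_1 with τ_1 ≥ 0 and E[τ_1(X_1)^2] < ∞. Let W = (X_1 + … + X_n)/√n and Z ~ N(0,1). Then there exists a universal constant C such that for every measurable h : ℝ → ℝ with ‖h‖_∞ ≤ 1, |E[h(W)] − E[h(Z)] − (γ/(6√n))·E[(Z^3 − 3Z)·h(Z)]| ≤ (C/n)·(E[X_1^4] + E[τ_1(X_1)^2]). -/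
open MeasureTheory ProbabilityTheory
open scoped ENNReal

/-- A measurable function `τ : ℝ → ℝ` is a *Stein kernel* for a distribution `μ` with mean `m`
if `E[(X - m) f(X)] = E[τ(X) f'(X)]` for every differentiable `f : ℝ → ℝ` that is bounded
with bounded derivative and for which both expectations exist. -/
def IsSteinKernel (μ : Measure ℝ) (m : ℝ) (τ : ℝ → ℝ) : Prop :=
  Measurable τ ∧
  ∀ f : ℝ → ℝ, Differentiable ℝ f →
    (∃ M, ∀ x, |f x| ≤ M) → (∃ M, ∀ x, |deriv f x| ≤ M) →
    Integrable (fun x => (x - m) * f x) μ →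
    Integrable (fun x => τ x * deriv f x) μ →
    ∫ x, (x - m) * f x ∂μ = ∫ x, τ x * deriv f x ∂μ

namespace SteinEdgeworth

open Set Filter

lemma integrable_exp_neg_half_sq : Integrable fun t : ℝ => Real.exp (-t ^ 2 / 2) := by
  convert integrable_exp_neg_mul_sq (b := 1 / 2) (by norm_num) using 3
  ring

lemma integral_exp_neg_half_sq_le : ∫ t : ℝ, Real.exp (-t ^ 2 / 2) ≤ 3 := by
  have h : ∫ t : ℝ, Real.exp (-t ^ 2 / 2) = √(2 * Real.pi) := by
    rw [← (by ring : Real.pi / (1 / 2) = 2 * Real.pi), ← integral_gaussian (1 / 2)]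
    congr with t
    ring_nf
  rw [h, Real.sqrt_le_iff]
  constructor <;> nlinarith [Real.pi_le_four, Real.pi_gt_three]

lemma hasDerivAt_exp_neg_half_sq (t : ℝ) :
    HasDerivAt (fun t : ℝ => Real.exp (-t ^ 2 / 2)) (-t * Real.exp (-t ^ 2 / 2)) t := by
  have h : HasDerivAt (fun t : ℝ => -t ^ 2 / 2) (-t) t := by
    convert! ((hasDerivAt_pow 2 t).neg.div_const 2) using 1
    simp; ring
  convert! h.exp using 1
  ring

lemma hasDerivAt_exp_half_sq (t : ℝ) :
    HasDerivAt (fun t : ℝ => Real.exp (t ^ 2 / 2)) (t * Real.exp (t ^ 2 / 2)) t := by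
  have h : HasDerivAt (fun t : ℝ => t ^ 2 / 2) t t := by
    convert! ((hasDerivAt_pow 2 t).div_const 2) using 1
    simp
  convert! h.exp using 1
  ring

lemma setIntegral_Iic_exp_neg_half_sq_le {x : ℝ} (hx : x ≤ 0) :
    ∫ t in Iic x, Real.exp (-t ^ 2 / 2) ≤ 3 * Real.exp (-x ^ 2 / 2) := by
  have hi := integrable_exp_neg_half_sq.comp_sub_right x
  calc ∫ t in Iic x, Real.exp (-t ^ 2 / 2)
      ≤ ∫ t in Iic x, Real.exp (-(t - x) ^ 2 / 2) * Real.exp (-x ^ 2 / 2) := by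
        refine setIntegral_mono_on integrable_exp_neg_half_sq.integrableOn
          (hi.mul_const _).integrableOn measurableSet_Iic fun t ht => ?_
        rw [← Real.exp_add, Real.exp_le_exp]
        have : t ≤ x := ht
        nlinarith [mul_nonneg (sub_nonneg.2 this) (neg_nonneg.2 hx)]
    _ ≤ ∫ t, Real.exp (-(t - x) ^ 2 / 2) * Real.exp (-x ^ 2 / 2) :=
        setIntegral_le_integral (hi.mul_const _) (ae_of_all _ fun t => by positivity)
    _ = (∫ t : ℝ, Real.exp (-t ^ 2 / 2)) * Real.exp (-x ^ 2 / 2) := by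
        rw [integral_mul_const, integral_sub_right_eq_self (fun t : ℝ => Real.exp (-t ^ 2 / 2))]
    _ ≤ _ := by gcongr; exact integral_exp_neg_half_sq_le

lemma integrable_mul_exp_neg_half_sq : Integrable fun t : ℝ => -t * Real.exp (-t ^ 2 / 2) := by
  convert (integrable_mul_exp_neg_mul_sq (b := 1 / 2) (by norm_num)).neg using 2
  simp only [Pi.neg_apply]
  ring_nf

lemma neg_mul_setIntegral_Iic_exp_neg_half_sq_le (x : ℝ) :
    -x * ∫ t in Iic x, Real.exp (-t ^ 2 / 2) ≤ Real.exp (-x ^ 2 / 2) := by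
  have h0 : Tendsto (fun t : ℝ => Real.exp (-t ^ 2 / 2)) atBot (nhds 0) :=
    tendsto_zero_of_hasDerivAt_of_integrableOn_Iic (a := 0)
      (fun t _ => hasDerivAt_exp_neg_half_sq t) integrable_mul_exp_neg_half_sq.integrableOn
      integrable_exp_neg_half_sq.integrableOn
  have h1 := integral_Iic_of_hasDerivAt_of_tendsto' (a := x)
      (fun t _ => hasDerivAt_exp_neg_half_sq t) integrable_mul_exp_neg_half_sq.integrableOn h0
  rw [sub_zero] at h1
  rw [← h1, ← integral_const_mul]
  refine setIntegral_mono_on (integrable_exp_neg_half_sq.const_mul _).integrableOn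
    integrable_mul_exp_neg_half_sq.integrableOn measurableSet_Iic fun t ht => ?_
  have : t ≤ x := ht
  gcongr

lemma abs_setIntegral_Iic_le {k : ℝ → ℝ} (hk : Continuous k) {M : ℝ} (hM : ∀ x, |k x| ≤ M)
    (h0 : ∫ t, k t * Real.exp (-t ^ 2 / 2) = 0) (x : ℝ) :
    |∫ t in Iic x, k t * Real.exp (-t ^ 2 / 2)| ≤
      M * ∫ t in Iic (-|x|), Real.exp (-t ^ 2 / 2) := by
  have hi : Integrable fun t => k t * Real.exp (-t ^ 2 / 2) :=
    integrable_exp_neg_half_sq.bdd_mul hk.aestronglyMeasurable (ae_of_all _ hM)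
  have key : ∀ s : Set ℝ, MeasurableSet s → |∫ t in s, k t * Real.exp (-t ^ 2 / 2)| ≤
      M * ∫ t in s, Real.exp (-t ^ 2 / 2) := by
    intro s hs
    rw [← integral_const_mul]
    refine (abs_integral_le_integral_abs).trans ?_
    refine setIntegral_mono_on hi.abs.integrableOn
      (integrable_exp_neg_half_sq.const_mul _).integrableOn hs fun t _ => ?_
    rw [abs_mul, Real.abs_exp]
    exact mul_le_mul_of_nonneg_right (hM t) (Real.exp_pos _).le
  rcases le_total x 0 with hx | hx
  · rw [abs_of_nonpos hx, neg_neg]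
    exact key _ measurableSet_Iic
  · have h1 : ∫ t in Iic x, k t * Real.exp (-t ^ 2 / 2) =
        -∫ t in Ioi x, k t * Real.exp (-t ^ 2 / 2) := by
      rw [eq_neg_iff_add_eq_zero, ← h0, ← compl_Iic]
      exact integral_add_compl measurableSet_Iic hi
    rw [h1, abs_neg, abs_of_nonneg hx]
    refine (key _ measurableSet_Ioi).trans_eq ?_
    congr 1
    have := integral_comp_neg_Iic (-x) fun t : ℝ => Real.exp (-t ^ 2 / 2)
    rw [neg_neg] at this
    rw [← this]
    simp

lemma integral_gaussianReal_eq (f : ℝ → ℝ) :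
    ∫ z, f z ∂(gaussianReal 0 1) = (√(2 * Real.pi))⁻¹ * ∫ z, f z * Real.exp (-z ^ 2 / 2) := by
  rw [integral_gaussianReal_eq_integral_smul one_ne_zero, ← integral_const_mul]
  congr with z
  simp [gaussianPDFReal]
  ring

/-- Bounded solutions with bounded continuous derivative of the Stein equation. -/
lemma exists_stein_solution {g : ℝ → ℝ} (hg : Continuous g) {B : ℝ} (hB : ∀ x, |g x| ≤ B) :
    ∃ F : ℝ → ℝ, Differentiable ℝ F ∧ Continuous (deriv F) ∧ (∀ x, |F x| ≤ 6 * B) ∧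
      (∀ x, |deriv F x| ≤ 4 * B) ∧
      ∀ x, deriv F x - x * F x = g x - ∫ z, g z ∂(gaussianReal 0 1) := by
  set m := ∫ z, g z ∂(gaussianReal 0 1) with hm
  have hm' : |m| ≤ B := by
    refine (norm_integral_le_of_norm_le_const (f := g) (μ := gaussianReal 0 1)
      (ae_of_all _ hB)).trans_eq ?_
    simp
  set k : ℝ → ℝ := fun x => g x - m with hkdef
  have hk : Continuous k := hg.sub continuous_const
  have hkM : ∀ x, |k x| ≤ 2 * B := fun x => by
    have := abs_sub (g x) m
    linarith [hB x, this.trans (add_le_add (hB x) hm')]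
  have hgi : Integrable g (gaussianReal 0 1) :=
    Integrable.of_bound hg.aestronglyMeasurable B (ae_of_all _ hB)
  have hk0 : ∫ t, k t * Real.exp (-t ^ 2 / 2) = 0 := by
    have h1 : ∫ t, k t ∂(gaussianReal 0 1) = 0 := by
      simp only [hkdef]
      rw [integral_sub hgi (integrable_const _)]
      simp [hm]
    rw [integral_gaussianReal_eq] at h1
    exact (mul_eq_zero.1 h1).resolve_left (by positivity)
  have hi : Integrable fun t => k t * Real.exp (-t ^ 2 / 2) :=
    integrable_exp_neg_half_sq.bdd_mul hk.aestronglyMeasurable (ae_of_all _ hkM)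
  have hc : Continuous fun t => k t * Real.exp (-t ^ 2 / 2) := by fun_prop
  set J : ℝ → ℝ := fun x => ∫ t in Iic x, k t * Real.exp (-t ^ 2 / 2) with hJ
  have hJd : ∀ x, HasDerivAt J (k x * Real.exp (-x ^ 2 / 2)) x := by
    intro x
    have h1 : J = fun y => J 0 + ∫ t in (0 : ℝ)..y, k t * Real.exp (-t ^ 2 / 2) := by
      ext y
      rw [← intervalIntegral.integral_Iic_sub_Iic hi.integrableOn hi.integrableOn]
      simp [hJ]
    rw [h1]
    exact (intervalIntegral.integral_hasDerivAt_right hi.intervalIntegrable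
      (hc.stronglyMeasurableAtFilter _ _) hc.continuousAt).const_add _
  set F : ℝ → ℝ := fun x => Real.exp (x ^ 2 / 2) * J x with hF
  have hee : ∀ x : ℝ, Real.exp (x ^ 2 / 2) * Real.exp (-x ^ 2 / 2) = 1 := fun x => by
    rw [← Real.exp_add, ← Real.exp_zero]; ring_nf
  have hFd : ∀ x, HasDerivAt F (x * F x + k x) x := by
    intro x
    convert! (hasDerivAt_exp_half_sq x).mul (hJd x) using 1
    simp only [hF]
    linear_combination (-k x) * hee x
  have hB0 : 0 ≤ B := (abs_nonneg _).trans (hB 0)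
  have hFb : ∀ x, |F x| ≤ 6 * B := by
    intro x
    have h1 := abs_setIntegral_Iic_le hk hkM hk0 x
    have h2 := setIntegral_Iic_exp_neg_half_sq_le (neg_nonpos.2 (abs_nonneg x))
    simp only [neg_sq, sq_abs] at h2
    calc |F x| = Real.exp (x ^ 2 / 2) * |J x| := by rw [hF, abs_mul, Real.abs_exp]
      _ ≤ Real.exp (x ^ 2 / 2) * (2 * B * (3 * Real.exp (-x ^ 2 / 2))) := by
        gcongr
        exact h1.trans (by gcongr)
      _ = 6 * B := by linear_combination 6 * B * hee x
  have hxFb : ∀ x, |x * F x| ≤ 2 * B := by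
    intro x
    have h1 := abs_setIntegral_Iic_le hk hkM hk0 x
    have h2 := neg_mul_setIntegral_Iic_exp_neg_half_sq_le (-|x|)
    simp only [neg_sq, sq_abs, neg_neg] at h2
    calc |x * F x| = Real.exp (x ^ 2 / 2) * (|x| * |J x|) := by
          rw [hF, abs_mul, abs_mul, Real.abs_exp]; ring
      _ ≤ Real.exp (x ^ 2 / 2) * (|x| * (2 * B * ∫ t in Iic (-|x|), Real.exp (-t ^ 2 / 2))) := by
        gcongr
      _ = Real.exp (x ^ 2 / 2) * (2 * B * (|x| * ∫ t in Iic (-|x|), Real.exp (-t ^ 2 / 2))) := by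
        ring
      _ ≤ Real.exp (x ^ 2 / 2) * (2 * B * Real.exp (-x ^ 2 / 2)) := by gcongr
      _ = 2 * B := by linear_combination 2 * B * hee x
  have hdF : deriv F = fun x => x * F x + k x := funext fun x => (hFd x).deriv
  have hFdiff : Differentiable ℝ F := fun x => (hFd x).differentiableAt
  refine ⟨F, hFdiff, ?_, hFb, fun x => ?_, fun x => ?_⟩
  · rw [hdF]
    exact (continuous_id.mul hFdiff.continuous).add hk
  · rw [hdF]
    exact (abs_add_le _ _).trans (by linarith [hxFb x, hkM x])
  · rw [hdF]
    simp only [hkdef]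
    ring

lemma integrable_mul_exp_of_integrable_gaussianReal {f : ℝ → ℝ}
    (hf : Integrable f (gaussianReal 0 1)) :
    Integrable fun z => f z * Real.exp (-z ^ 2 / 2) := by
  rw [gaussianReal_of_var_ne_zero _ one_ne_zero, integrable_withDensity_iff_integrable_smul'
    (measurable_gaussianPDF _ _) (ae_of_all _ fun _ => gaussianPDF_lt_top)] at hf
  refine (hf.const_mul (√(2 * Real.pi))).congr (ae_of_all _ fun z => ?_)
  have : √(2 * Real.pi) ≠ 0 := by positivity
  simp only [toReal_gaussianPDF, gaussianPDFReal, smul_eq_mul, NNReal.coe_one, mul_one, sub_zero]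
  field_simp

/-- Gaussian integration by parts. -/
lemma integral_gaussianReal_deriv_sub_mul {φ φ' : ℝ → ℝ} (hφ : ∀ z, HasDerivAt φ (φ' z) z)
    (hi : Integrable φ (gaussianReal 0 1))
    (hi' : Integrable (fun z => φ' z - z * φ z) (gaussianReal 0 1)) :
    ∫ z, (φ' z - z * φ z) ∂(gaussianReal 0 1) = 0 := by
  rw [integral_gaussianReal_eq, mul_eq_zero]
  right
  refine integral_eq_zero_of_hasDerivAt_of_integrable
    (f := fun z => φ z * Real.exp (-z ^ 2 / 2)) (fun z => ?_)
    (integrable_mul_exp_of_integrable_gaussianReal hi')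
    (integrable_mul_exp_of_integrable_gaussianReal hi)
  convert! (hφ z).mul (hasDerivAt_exp_neg_half_sq z) using 1
  ring

lemma integrable_pow_gaussianReal (k : ℕ) : Integrable (fun z : ℝ => z ^ k) (gaussianReal 0 1) := by
  have h := (memLp_id_gaussianReal (μ := 0) (v := 1) k).integrable_norm_pow'
  refine h.mono' (by fun_prop) (ae_of_all _ fun z => ?_)
  simp

lemma integrable_pow_mul_gaussianReal (k : ℕ) {u : ℝ → ℝ} (hu : Measurable u) {B : ℝ}
    (hB : ∀ z, |u z| ≤ B) : Integrable (fun z : ℝ => z ^ k * u z) (gaussianReal 0 1) :=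
  (integrable_pow_gaussianReal k).mul_bdd hu.aestronglyMeasurable (ae_of_all _ hB)

/-- The mean of an iterated Stein solution in terms of the third Hermite polynomial. -/
lemma integral_iterated_stein_solution {h f F : ℝ → ℝ} {B m m' : ℝ}
    (hh : Continuous h) (hhB : ∀ z, |h z| ≤ B)
    (hf : Differentiable ℝ f) (hf' : Continuous (deriv f)) (hfB : ∀ z, |f z| ≤ B)
    (hfB' : ∀ z, |deriv f z| ≤ B) (hfs : ∀ z, deriv f z - z * f z = h z - m)
    (hF : Differentiable ℝ F) (hFB : ∀ z, |F z| ≤ B)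
    (hFs : ∀ z, deriv F z - z * F z = deriv f z - m') :
    3 * ∫ z, F z ∂(gaussianReal 0 1) = ∫ z, (z ^ 3 - 3 * z) * h z ∂(gaussianReal 0 1) := by
  have ih := fun k => integrable_pow_mul_gaussianReal k hh.measurable hhB
  have jf := fun k => integrable_pow_mul_gaussianReal k hf.continuous.measurable hfB
  have jf' := fun k => integrable_pow_mul_gaussianReal k hf'.measurable hfB'
  have jF := fun k => integrable_pow_mul_gaussianReal k hF.continuous.measurable hFB
  have ip := integrable_pow_gaussianReal
  have e1 : ∫ z : ℝ, z ^ 1 ∂(gaussianReal 0 1) = 0 := by simp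
  have e3 : ∫ z : ℝ, z ^ 3 ∂(gaussianReal 0 1) = 0 := by
    have heq : (fun z : ℝ => 2 * z - z * z ^ 2) = fun z : ℝ => 2 * z ^ 1 - z ^ 3 := by
      ext z; ring
    have := integral_gaussianReal_deriv_sub_mul (φ := fun z => z ^ 2) (φ' := fun z => 2 * z)
      (fun z => by simpa using hasDerivAt_pow 2 z) (ip 2)
      (by rw [heq]; exact ((ip 1).const_mul 2).sub (ip 3))
    rw [heq, integral_sub ((ip 1).const_mul 2) (ip 3), integral_const_mul, e1] at this
    linarith
  have h1 : (∫ z, F z ∂(gaussianReal 0 1)) + ∫ z, z ^ 1 * deriv f z ∂(gaussianReal 0 1) = 0 := by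
    have heq : (fun z : ℝ => (1 * F z + z * deriv F z) - z * (z * F z)) =
        fun z => (z ^ 0 * F z + z ^ 1 * deriv f z) - m' * z ^ 1 := by
      ext z; linear_combination z * hFs z
    have := integral_gaussianReal_deriv_sub_mul (φ := fun z => z * F z)
      (φ' := fun z => 1 * F z + z * deriv F z)
      (fun z => (hasDerivAt_id z).mul (hF z).hasDerivAt) (by simpa using jF 1)
      (by rw [heq]; exact ((jF 0).add (jf' 1)).sub ((ip 1).const_mul m'))
    rw [heq, integral_sub (by exact (jF 0).add (jf' 1)) ((ip 1).const_mul m'), integral_const_mul, e1,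
      integral_add (jF 0) (jf' 1)] at this
    simpa using this
  have h2 : (∫ z, z ^ 0 * f z ∂(gaussianReal 0 1)) + (∫ z, z ^ 1 * deriv f z ∂(gaussianReal 0 1)) -
      ∫ z, z ^ 2 * f z ∂(gaussianReal 0 1) = 0 := by
    have heq : (fun z : ℝ => (1 * f z + z * deriv f z) - z * (z * f z)) =
        fun z => (z ^ 0 * f z + z ^ 1 * deriv f z) - z ^ 2 * f z := by
      ext z; ring
    have := integral_gaussianReal_deriv_sub_mul (φ := fun z => z * f z)
      (φ' := fun z => 1 * f z + z * deriv f z)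
      (fun z => (hasDerivAt_id z).mul (hf z).hasDerivAt) (by simpa using jf 1)
      (by rw [heq]; exact ((jf 0).add (jf' 1)).sub (jf 2))
    rwa [heq, integral_sub (by exact (jf 0).add (jf' 1)) (jf 2), integral_add (jf 0) (jf' 1)] at this
  have iH : Integrable (fun z => (z ^ 3 - 3 * z) * h z) (gaussianReal 0 1) := by
    refine ((ih 3).sub ((ih 1).const_mul 3)).congr (ae_of_all _ fun z => ?_)
    simp only [Pi.sub_apply]
    ring
  have h3 : (∫ z, (z ^ 3 - 3 * z) * h z ∂(gaussianReal 0 1)) +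
      3 * (∫ z, z ^ 2 * f z ∂(gaussianReal 0 1)) - 3 * ∫ z, z ^ 0 * f z ∂(gaussianReal 0 1) = 0 := by
    have i1 := iH.add ((jf 2).const_mul 3)
    have i2 := i1.sub ((jf 0).const_mul 3)
    have i3 := (ip 3).const_mul m
    have i4 := (ip 1).const_mul (3 * m)
    have heq : (fun z : ℝ => ((3 * z ^ 2 - 3) * f z + (z ^ 3 - 3 * z) * deriv f z) -
        z * ((z ^ 3 - 3 * z) * f z)) = fun z => ((z ^ 3 - 3 * z) * h z + 3 * (z ^ 2 * f z) -
          3 * (z ^ 0 * f z)) - m * z ^ 3 + 3 * m * z ^ 1 := by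
      ext z; linear_combination (z ^ 3 - 3 * z) * hfs z
    have := integral_gaussianReal_deriv_sub_mul (φ := fun z => (z ^ 3 - 3 * z) * f z)
      (φ' := fun z => (3 * z ^ 2 - 3) * f z + (z ^ 3 - 3 * z) * deriv f z)
      (fun z => by
        refine HasDerivAt.mul ?_ (hf z).hasDerivAt
        convert! (hasDerivAt_pow 3 z).sub ((hasDerivAt_id z).const_mul 3) using 1
        simp)
      (by
        refine ((jf 3).sub ((jf 1).const_mul 3)).congr (ae_of_all _ fun z => ?_)
        simp only [Pi.sub_apply]
        ring)
      (by rw [heq]; exact (i2.sub i3).add i4)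
    rw [heq, integral_add (by exact i2.sub i3) i4, integral_sub (by exact i2) i3,
      integral_sub (by exact i1) ((jf 0).const_mul 3), integral_add iH ((jf 2).const_mul 3)] at this
    simp only [integral_const_mul] at this
    rw [e1, e3] at this
    linarith
  linarith

lemma integrable_of_integrable_pow_four {μ : Measure ℝ} [IsProbabilityMeasure μ]
    (h4 : Integrable (fun x => x ^ 4) μ) :
    Integrable (fun x => x) μ ∧ MemLp (fun x => x) 2 μ ∧ Integrable (fun x => |x| ^ 3) μ := by
  have h : ∀ k ≤ 4, Integrable (fun x : ℝ => |x| ^ k) μ := fun k hk => by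
    refine ((integrable_const 1).add h4).mono' (by fun_prop) (ae_of_all _ fun x => ?_)
    rw [Real.norm_of_nonneg (by positivity), Pi.add_apply]
    have h4' : |x| ^ 4 = x ^ 4 := by rw [pow_abs, abs_of_nonneg (by positivity)]
    rcases le_total |x| 1 with hx | hx
    · have := pow_le_one₀ (abs_nonneg x) hx (n := k)
      nlinarith [sq_nonneg (x ^ 2)]
    · have := pow_le_pow_right₀ hx hk
      linarith
  refine ⟨(h 1 (by norm_num)).mono' (by fun_prop) (ae_of_all _ fun x => by simp), ?_,
    h 3 (by norm_num)⟩
  rw [memLp_two_iff_integrable_sq (by fun_prop)]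
  simpa using h 2 (by norm_num)

lemma tendsto_mul_sin_div (x : ℝ) :
    Tendsto (fun k : ℕ => ((k : ℝ) + 1) * Real.sin (x / ((k : ℝ) + 1))) atTop (nhds x) := by
  have h1 : HasDerivAt (fun t => Real.sin (x * t)) x 0 := by
    simpa using ((hasDerivAt_id (0 : ℝ)).const_mul x).sin
  have h2 := h1.tendsto_slope_zero
  have h3 : Tendsto (fun k : ℕ => 1 / ((k : ℝ) + 1)) atTop (nhdsWithin 0 {0}ᶜ) :=
    tendsto_nhdsWithin_iff.2 ⟨tendsto_one_div_add_atTop_nhds_zero_nat,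
      Eventually.of_forall fun k => by simp only [mem_compl_iff, mem_singleton_iff]; positivity⟩
  refine (h2.comp h3).congr fun k => ?_
  simp [div_eq_mul_inv]

lemma abs_mul_sin_div_le (x c : ℝ) (hc : 0 < c) : |c * Real.sin (x / c)| ≤ |x| := by
  rw [abs_mul, abs_of_pos hc]
  calc c * |Real.sin (x / c)| ≤ c * |x / c| := mul_le_mul_of_nonneg_left Real.abs_sin_le_abs hc.le
    _ = |x| := by rw [abs_div, abs_of_pos hc]; field_simp

/-- A Stein kernel has mean equal to the variance. -/
lemma integral_steinKernel_eq {μ : Measure ℝ} [IsProbabilityMeasure μ] {τ : ℝ → ℝ}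
    (h : IsSteinKernel μ 0 τ) (h4 : Integrable (fun x => x ^ 4) μ) (hτ : Integrable τ μ) :
    ∫ x, τ x ∂μ = ∫ x, x ^ 2 ∂μ := by
  obtain ⟨i1, i2, -⟩ := integrable_of_integrable_pow_four h4
  have hd : ∀ k : ℕ, ∀ x, HasDerivAt (fun x => ((k : ℝ) + 1) * Real.sin (x / ((k : ℝ) + 1)))
      (Real.cos (x / ((k : ℝ) + 1))) x := fun k x => by
    convert! (((hasDerivAt_id x).div_const ((k : ℝ) + 1)).sin).const_mul ((k : ℝ) + 1) using 1
    have : (k : ℝ) + 1 ≠ 0 := by positivity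
    field_simp
    simp
  have key : ∀ k : ℕ, ∫ x, x * (((k : ℝ) + 1) * Real.sin (x / ((k : ℝ) + 1))) ∂μ =
      ∫ x, τ x * Real.cos (x / ((k : ℝ) + 1)) ∂μ := by
    intro k
    have hd' := funext fun x => (hd k x).deriv
    have hb : ∀ x, |((k : ℝ) + 1) * Real.sin (x / ((k : ℝ) + 1))| ≤ k + 1 := fun x => by
      rw [abs_mul, abs_of_pos (by positivity : (0 : ℝ) < k + 1)]
      exact mul_le_of_le_one_right (by positivity) (Real.abs_sin_le_one _)
    have := h.2 (fun x => ((k : ℝ) + 1) * Real.sin (x / ((k : ℝ) + 1)))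
      (fun x => (hd k x).differentiableAt) ⟨_, hb⟩
      ⟨1, fun x => by rw [(hd k x).deriv]; exact Real.abs_cos_le_one _⟩
      (by simpa using i1.mul_bdd (by fun_prop) (ae_of_all _ hb))
      (by
        rw [hd']
        exact hτ.mul_bdd (c := 1) (by fun_prop) (ae_of_all _ fun x => Real.abs_cos_le_one _))
    simpa [hd'] using this
  have l1 : Tendsto (fun k : ℕ => ∫ x, x * (((k : ℝ) + 1) * Real.sin (x / ((k : ℝ) + 1))) ∂μ) atTop
      (nhds (∫ x, x ^ 2 ∂μ)) := by
    refine tendsto_integral_of_dominated_convergence (fun x => x ^ 2) (fun k => by fun_prop)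
      i2.integrable_sq (fun k => ae_of_all _ fun x => ?_) (ae_of_all _ fun x => ?_)
    · rw [Real.norm_eq_abs, abs_mul, ← sq_abs, sq]
      exact mul_le_mul_of_nonneg_left (abs_mul_sin_div_le x ((k : ℝ) + 1) (by positivity))
        (abs_nonneg x)
    · rw [sq]
      exact (tendsto_mul_sin_div x).const_mul x
  have l2 : Tendsto (fun k : ℕ => ∫ x, τ x * Real.cos (x / ((k : ℝ) + 1)) ∂μ) atTop
      (nhds (∫ x, τ x ∂μ)) := by
    refine tendsto_integral_of_dominated_convergence (fun x => |τ x|)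
      (fun k => hτ.aestronglyMeasurable.mul (by fun_prop))
      hτ.abs (fun k => ae_of_all _ fun x => ?_) (ae_of_all _ fun x => ?_)
    · rw [Real.norm_eq_abs, abs_mul]
      exact mul_le_of_le_one_right (abs_nonneg _) (Real.abs_cos_le_one _)
    · have : Tendsto (fun k : ℕ => x * (1 / ((k : ℝ) + 1))) atTop (nhds (x * 0)) :=
        tendsto_one_div_add_atTop_nhds_zero_nat.const_mul x
      have := ((Real.continuous_cos.tendsto _).comp this).const_mul (τ x)
      simpa [Function.comp_def, div_eq_mul_inv] using this
  exact tendsto_nhds_unique l2 (l1.congr key)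

/-- The covariance of a variable and its Stein kernel is half the third moment. -/
lemma two_mul_integral_steinKernel_mul_eq {μ : Measure ℝ} [IsProbabilityMeasure μ] {τ : ℝ → ℝ}
    (h : IsSteinKernel μ 0 τ) (h4 : Integrable (fun x => x ^ 4) μ) (hτ : MemLp τ 2 μ) :
    2 * ∫ x, τ x * x ∂μ = ∫ x, x ^ 3 ∂μ := by
  obtain ⟨i1, i2, i3⟩ := integrable_of_integrable_pow_four h4
  have hτ1 : Integrable τ μ := hτ.integrable (by norm_num)
  have hτx : Integrable (fun x => τ x * x) μ := hτ.integrable_mul i2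
  have hd : ∀ k : ℕ, ∀ x, HasDerivAt (fun x => (((k : ℝ) + 1) * Real.sin (x / ((k : ℝ) + 1))) ^ 2)
      (2 * (((k : ℝ) + 1) * Real.sin (x / ((k : ℝ) + 1)) * Real.cos (x / ((k : ℝ) + 1)))) x :=
    fun k x => by
    convert! ((((hasDerivAt_id x).div_const ((k : ℝ) + 1)).sin).const_mul ((k : ℝ) + 1)).pow 2
      using 1
    have : (k : ℝ) + 1 ≠ 0 := by positivity
    field_simp
    simp only [id, Nat.cast_ofNat, Nat.add_one_sub_one, pow_one]
    ring
  have hb : ∀ (k : ℕ) x, |((k : ℝ) + 1) * Real.sin (x / ((k : ℝ) + 1))| ≤ k + 1 := fun k x => by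
    rw [abs_mul, abs_of_pos (by positivity : (0 : ℝ) < k + 1)]
    exact mul_le_of_le_one_right (by positivity) (Real.abs_sin_le_one _)
  have key : ∀ k : ℕ, ∫ x, x * (((k : ℝ) + 1) * Real.sin (x / ((k : ℝ) + 1))) ^ 2 ∂μ =
      ∫ x, τ x * (2 * (((k : ℝ) + 1) * Real.sin (x / ((k : ℝ) + 1)) *
        Real.cos (x / ((k : ℝ) + 1)))) ∂μ := by
    intro k
    have hd' := funext fun x => (hd k x).deriv
    have hb2 : ∀ x, |(((k : ℝ) + 1) * Real.sin (x / ((k : ℝ) + 1))) ^ 2| ≤ ((k : ℝ) + 1) ^ 2 :=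
      fun x => by
      rw [abs_pow]
      gcongr
      exact hb k x
    have hb3 : ∀ x, |2 * (((k : ℝ) + 1) * Real.sin (x / ((k : ℝ) + 1)) *
        Real.cos (x / ((k : ℝ) + 1)))| ≤ 2 * ((k + 1) * 1) := fun x => by
      rw [abs_mul, abs_mul, abs_two]
      gcongr
      · exact hb k x
      · exact Real.abs_cos_le_one _
    have := h.2 (fun x => (((k : ℝ) + 1) * Real.sin (x / ((k : ℝ) + 1))) ^ 2)
      (fun x => (hd k x).differentiableAt) ⟨_, hb2⟩
      ⟨_, fun x => by rw [(hd k x).deriv]; exact hb3 x⟩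
      (by simpa using i1.mul_bdd (by fun_prop) (ae_of_all _ hb2))
      (by
        rw [hd']
        exact hτ1.mul_bdd (by fun_prop) (ae_of_all _ hb3))
    simpa [hd'] using this
  have l1 : Tendsto (fun k : ℕ => ∫ x, x * (((k : ℝ) + 1) * Real.sin (x / ((k : ℝ) + 1))) ^ 2 ∂μ)
      atTop (nhds (∫ x, x ^ 3 ∂μ)) := by
    refine tendsto_integral_of_dominated_convergence (fun x => |x| ^ 3) (fun k => by fun_prop)
      i3 (fun k => ae_of_all _ fun x => ?_) (ae_of_all _ fun x => ?_)
    · rw [Real.norm_eq_abs, abs_mul, abs_pow, pow_succ' |x| 2]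
      exact mul_le_mul_of_nonneg_left (pow_le_pow_left₀ (abs_nonneg _)
        (abs_mul_sin_div_le x ((k : ℝ) + 1) (by positivity)) 2) (abs_nonneg x)
    · rw [pow_succ' x 2]
      exact ((tendsto_mul_sin_div x).pow 2).const_mul x
  have l2 : Tendsto (fun k : ℕ => ∫ x, τ x * (2 * (((k : ℝ) + 1) * Real.sin (x / ((k : ℝ) + 1)) *
        Real.cos (x / ((k : ℝ) + 1)))) ∂μ) atTop (nhds (∫ x, τ x * (2 * (x * 1)) ∂μ)) := by
    refine tendsto_integral_of_dominated_convergence (fun x => 2 * |τ x * x|)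
      (fun k => hτ1.aestronglyMeasurable.mul (by fun_prop))
      (hτx.abs.const_mul 2) (fun k => ae_of_all _ fun x => ?_) (ae_of_all _ fun x => ?_)
    · rw [Real.norm_eq_abs, abs_mul, abs_mul, abs_mul _ (Real.cos _), abs_mul (τ x) x, abs_two]
      have := mul_le_mul (abs_mul_sin_div_le x ((k : ℝ) + 1) (by positivity))
        (Real.abs_cos_le_one (x / ((k : ℝ) + 1))) (abs_nonneg _) (abs_nonneg _)
      nlinarith [mul_le_mul_of_nonneg_left this (abs_nonneg (τ x))]
    · have : Tendsto (fun k : ℕ => x * (1 / ((k : ℝ) + 1))) atTop (nhds (x * 0)) :=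
        tendsto_one_div_add_atTop_nhds_zero_nat.const_mul x
      have h2 : Tendsto (fun k : ℕ => Real.cos (x / ((k : ℝ) + 1))) atTop (nhds 1) := by
        simpa [Function.comp_def, div_eq_mul_inv] using (Real.continuous_cos.tendsto _).comp this
      exact (((tendsto_mul_sin_div x).mul h2).const_mul 2).const_mul (τ x)
  rw [tendsto_nhds_unique (l1.congr key) l2, ← integral_const_mul]
  congr with x
  ring

lemma integral_pi_coord {μ : Measure ℝ} [IsProbabilityMeasure μ] {m : ℕ} (j : Fin (m + 1))
    {A : (Fin m → ℝ) → ℝ} (hA : Integrable A (Measure.pi fun _ => μ))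
    {b : ℝ → ℝ} (hb : Integrable b μ) {G : ℝ → ℝ} (hG : Measurable G) {B : ℝ}
    (hB : ∀ x, |G x| ≤ B) :
    ∫ ω, A (fun k => ω (j.succAbove k)) * (b (ω j) * G (∑ i, ω i)) ∂(Measure.pi fun _ => μ) =
      ∫ y, A y * ∫ x, b x * G (x + ∑ k, y k) ∂μ ∂(Measure.pi fun _ => μ) := by
  have hmp := measurePreserving_piFinSuccAbove (fun _ : Fin (m + 1) => μ) j
  have h1 := hmp.integral_comp' fun p : ℝ × (Fin m → ℝ) =>
    A p.2 * (b p.1 * G (p.1 + ∑ k, p.2 k))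
  have hint : Integrable (fun p : ℝ × (Fin m → ℝ) => A p.2 * (b p.1 * G (p.1 + ∑ k, p.2 k)))
      (μ.prod (Measure.pi fun _ => μ)) := by
    have hm : Measurable fun p : ℝ × (Fin m → ℝ) => G (p.1 + ∑ k, p.2 k) := by fun_prop
    refine ((hb.mul_prod hA).mul_bdd (c := B) hm.aestronglyMeasurable
      (ae_of_all _ fun p => hB _)).congr (ae_of_all _ fun p => ?_)
    ring
  calc _ = ∫ p : ℝ × (Fin m → ℝ), A p.2 * (b p.1 * G (p.1 + ∑ k, p.2 k))
        ∂(μ.prod (Measure.pi fun _ => μ)) := by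
        rw [← h1]
        congr with ω
        rw [Fin.sum_univ_succAbove _ j]
        rfl
    _ = _ := by
        rw [integral_prod_symm _ hint]
        simp only [integral_const_mul]

lemma integral_stein_shift {μ : Measure ℝ} {τ : ℝ → ℝ} (h : IsSteinKernel μ 0 τ)
    (hx : Integrable (fun x => x) μ) (hτ : Integrable τ μ) {F : ℝ → ℝ}
    (hF : Differentiable ℝ F) (hF' : Continuous (deriv F)) {B : ℝ} (hB : ∀ x, |F x| ≤ B)
    (hB' : ∀ x, |deriv F x| ≤ B) (s y : ℝ) :
    ∫ x, x * F ((x + y) / s) ∂μ = ∫ x, τ x * (deriv F ((x + y) / s) / s) ∂μ := by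
  have hd : ∀ x, HasDerivAt (fun x => F ((x + y) / s)) (deriv F ((x + y) / s) / s) x := fun x => by
    convert! (hF _).hasDerivAt.comp x (((hasDerivAt_id x).add_const y).div_const s) using 1
    simp [div_eq_mul_inv]
  have hd' := funext fun x => (hd x).deriv
  have hb : ∀ x, |deriv F ((x + y) / s) / s| ≤ B / |s| := fun x => by
    rw [abs_div]
    gcongr
    exact hB' _
  have hFc := hF.continuous
  have := h.2 (fun x => F ((x + y) / s)) (fun x => (hd x).differentiableAt) ⟨B, fun x => hB _⟩
    ⟨B / |s|, fun x => by rw [(hd x).deriv]; exact hb x⟩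
    (by simpa using hx.mul_bdd (by fun_prop) (ae_of_all _ fun x => hB _))
    (by
      rw [hd']
      exact hτ.mul_bdd (by fun_prop) (ae_of_all _ hb))
  simpa [hd'] using this

/-- The Stein identity in one coordinate of a product measure. -/
lemma integral_pi_stein {μ : Measure ℝ} [IsProbabilityMeasure μ] {τ : ℝ → ℝ}
    (h : IsSteinKernel μ 0 τ)
    (hx : Integrable (fun x => x) μ) (hτ : Integrable τ μ) {F : ℝ → ℝ}
    (hF : Differentiable ℝ F) (hF' : Continuous (deriv F)) {B : ℝ} (hB : ∀ x, |F x| ≤ B)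
    (hB' : ∀ x, |deriv F x| ≤ B) (s : ℝ) {m : ℕ} (j : Fin (m + 1))
    {A : (Fin m → ℝ) → ℝ} (hA : Integrable A (Measure.pi fun _ => μ)) :
    ∫ ω, A (fun k => ω (j.succAbove k)) * (ω j * F ((∑ i, ω i) / s)) ∂(Measure.pi fun _ => μ) =
      s⁻¹ * ∫ ω, A (fun k => ω (j.succAbove k)) * (τ (ω j) * deriv F ((∑ i, ω i) / s))
        ∂(Measure.pi fun _ => μ) := by
  have hFc := hF.continuous
  rw [integral_pi_coord j hA hx (G := fun t => F (t / s)) (by fun_prop) (fun x => hB _),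
    integral_pi_coord j hA hτ (G := fun t => deriv F (t / s)) (by fun_prop) (fun x => hB' _),
    ← integral_const_mul]
  refine integral_congr_ae (ae_of_all _ fun y => ?_)
  simp only
  rw [integral_stein_shift h hx hτ hF hF' hB hB', mul_left_comm, ← integral_const_mul s⁻¹]
  congr with x
  ring

/-- Decoupling of a centred function of one coordinate from a Lipschitz function of the sum. -/
lemma abs_integral_pi_coord_le {μ : Measure ℝ} [IsProbabilityMeasure μ]
    {b : ℝ → ℝ} (hb : Integrable b μ) (hb0 : ∫ x, b x ∂μ = 0)
    (hbx : Integrable (fun x => b x * x) μ) {F : ℝ → ℝ}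
    (hF : Differentiable ℝ F) {B : ℝ} (hB : ∀ x, |F x| ≤ B) (hB' : ∀ x, |deriv F x| ≤ B)
    {s : ℝ} (hs : 0 < s) {m : ℕ} (j : Fin (m + 1)) :
    |∫ ω, b (ω j) * F ((∑ i, ω i) / s) ∂(Measure.pi fun _ => μ)| ≤
      B / s * ∫ x, |b x * x| ∂μ := by
  have hFc := hF.continuous
  have h1 := integral_pi_coord (μ := μ) j (A := fun _ => 1) (integrable_const _) hb
    (G := fun t => F (t / s)) (by fun_prop) (fun x => hB _)
  simp only [one_mul] at h1
  rw [h1, ← Real.norm_eq_abs]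
  refine le_trans (norm_integral_le_of_norm_le_const (μ := Measure.pi fun _ : Fin m => μ)
    (C := B / s * ∫ x, |b x * x| ∂μ) (ae_of_all _ fun y => ?_)) (le_of_eq (by simp))
  set Y := ∑ k, y k
  have i1 : Integrable (fun x => b x * F ((x + Y) / s)) μ :=
    hb.mul_bdd (by fun_prop) (ae_of_all _ fun x => hB _)
  have h2 : ∫ x, b x * F ((x + Y) / s) ∂μ = ∫ x, b x * (F ((x + Y) / s) - F (Y / s)) ∂μ := by
    simp only [mul_sub]
    rw [integral_sub i1 (hb.mul_const _), integral_mul_const, hb0]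
    simp
  rw [h2, ← integral_const_mul]
  refine norm_integral_le_of_norm_le (hbx.abs.const_mul _) (ae_of_all _ fun x => ?_)
  have h3 : |F ((x + Y) / s) - F (Y / s)| ≤ B * |(x + Y) / s - Y / s| :=
    convex_univ.norm_image_sub_le_of_norm_deriv_le (𝕜 := ℝ) (fun x _ => hF x) (fun x _ => hB' x)
      (mem_univ _) (mem_univ _)
  rw [← sub_div, add_sub_cancel_right, abs_div, abs_of_pos hs] at h3
  rw [Real.norm_eq_abs, abs_mul, abs_mul]
  calc |b x| * |F ((x + Y) / s) - F (Y / s)| ≤ |b x| * (B * (|x| / s)) := by gcongr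
    _ = _ := by ring

lemma integrable_pi_eval {μ : Measure ℝ} [IsProbabilityMeasure μ] {ι : Type*} [Fintype ι] (i : ι)
    {a : ℝ → ℝ} (ha : Integrable a μ) :
    Integrable (fun ω : ι → ℝ => a (ω i)) (Measure.pi fun _ => μ) :=
  (measurePreserving_eval (fun _ => μ) i).integrable_comp_of_integrable ha

lemma memLp_pi_eval {μ : Measure ℝ} [IsProbabilityMeasure μ] {ι : Type*} [Fintype ι] (i : ι)
    {a : ℝ → ℝ} (ha : MemLp a 2 μ) :
    MemLp (fun ω : ι → ℝ => a (ω i)) 2 (Measure.pi fun _ => μ) :=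
  ha.comp_measurePreserving (measurePreserving_eval (fun _ => μ) i)

lemma integral_pi_eval {μ : Measure ℝ} [IsProbabilityMeasure μ] {ι : Type*} [Fintype ι] (i : ι)
    {a : ℝ → ℝ} (ha : AEStronglyMeasurable a μ) :
    ∫ ω : ι → ℝ, a (ω i) ∂(Measure.pi fun _ => μ) = ∫ x, a x ∂μ := by
  have h := (measurePreserving_eval (fun _ : ι => μ) i).map_eq
  have h2 := integral_map (μ := Measure.pi fun _ : ι => μ) (f := a)
    (measurable_pi_apply i).aemeasurable (by rwa [h])
  rw [h] at h2
  exact h2.symm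

lemma integral_deriv_sub_mul_pi {μ : Measure ℝ} [IsProbabilityMeasure μ] {τ : ℝ → ℝ}
    (h : IsSteinKernel μ 0 τ)
    (hx : Integrable (fun x => x) μ) (hτ : Integrable τ μ) {F : ℝ → ℝ}
    (hF : Differentiable ℝ F) (hF' : Continuous (deriv F)) {B : ℝ} (hB : ∀ x, |F x| ≤ B)
    (hB' : ∀ x, |deriv F x| ≤ B) {m : ℕ} {s : ℝ} (hs : s ^ 2 = m + 1) :
    ∫ ω : Fin (m + 1) → ℝ, (deriv F ((∑ i, ω i) / s) - (∑ i, ω i) / s * F ((∑ i, ω i) / s))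
        ∂(Measure.pi fun _ => μ) =
      ∫ ω : Fin (m + 1) → ℝ, (∑ i, (1 - τ (ω i))) / (m + 1) * deriv F ((∑ i, ω i) / s)
        ∂(Measure.pi fun _ => μ) := by
  have hFc := hF.continuous
  have hm : (m : ℝ) + 1 ≠ 0 := by positivity
  have i0 : Integrable (fun ω : Fin (m + 1) → ℝ => deriv F ((∑ i, ω i) / s))
      (Measure.pi fun _ => μ) := Integrable.of_bound (by fun_prop) B (ae_of_all _ fun ω => hB' _)
  have i1 : ∀ j, Integrable (fun ω : Fin (m + 1) → ℝ => ω j * F ((∑ i, ω i) / s))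
      (Measure.pi fun _ => μ) := fun j =>
    (integrable_pi_eval j hx).mul_bdd (by fun_prop) (ae_of_all _ fun ω => hB _)
  have i2 : ∀ j, Integrable (fun ω : Fin (m + 1) → ℝ => τ (ω j) * deriv F ((∑ i, ω i) / s))
      (Measure.pi fun _ => μ) := fun j =>
    (integrable_pi_eval j hτ).mul_bdd (by fun_prop) (ae_of_all _ fun ω => hB' _)
  have key : ∀ j, ∫ ω : Fin (m + 1) → ℝ, ω j * F ((∑ i, ω i) / s) ∂(Measure.pi fun _ => μ) =
      s⁻¹ * ∫ ω : Fin (m + 1) → ℝ, τ (ω j) * deriv F ((∑ i, ω i) / s)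
        ∂(Measure.pi fun _ => μ) := fun j => by
    simpa using integral_pi_stein h hx hτ hF hF' hB hB' s j (A := fun _ => 1) (integrable_const _)
  have e1 : ∀ ω : Fin (m + 1) → ℝ, (∑ i, ω i) / s * F ((∑ i, ω i) / s) =
      s⁻¹ * ∑ j, ω j * F ((∑ i, ω i) / s) := fun ω => by
    rw [← Finset.sum_mul]; ring
  have e2 : ∀ ω : Fin (m + 1) → ℝ, (∑ i, (1 - τ (ω i))) / (m + 1) * deriv F ((∑ i, ω i) / s) =
      deriv F ((∑ i, ω i) / s) - (m + 1 : ℝ)⁻¹ * ∑ j, τ (ω j) * deriv F ((∑ i, ω i) / s) :=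
    fun ω => by
    rw [← Finset.sum_mul, Finset.sum_sub_distrib]
    simp only [Finset.sum_const, Finset.card_univ, Fintype.card_fin, nsmul_eq_mul, mul_one]
    push_cast
    field_simp
  simp only [e1, e2]
  rw [integral_sub i0 ((integrable_finsetSum _ fun j _ => i1 j).const_mul _),
    integral_sub i0 ((integrable_finsetSum _ fun j _ => i2 j).const_mul _),
    integral_const_mul, integral_const_mul, integral_finsetSum _ fun j _ => i1 j,
    integral_finsetSum _ fun j _ => i2 j, ← hs, Finset.mul_sum, Finset.mul_sum]
  congr 1
  refine Finset.sum_congr rfl fun j _ => ?_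
  rw [key]
  ring

lemma integral_mul_deriv_sub_mul_pi {μ : Measure ℝ} [IsProbabilityMeasure μ] {τ : ℝ → ℝ}
    (h : IsSteinKernel μ 0 τ)
    (hx : MemLp (fun x => x) 2 μ) (hτ : MemLp τ 2 μ) {F : ℝ → ℝ}
    (hF : Differentiable ℝ F) (hF' : Continuous (deriv F)) {B : ℝ} (hB : ∀ x, |F x| ≤ B)
    (hB' : ∀ x, |deriv F x| ≤ B) {m : ℕ} {s : ℝ} (hs : s ^ 2 = m + 1) :
    ∫ ω : Fin (m + 1) → ℝ, (∑ i, (1 - τ (ω i))) / (m + 1) *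
        (deriv F ((∑ i, ω i) / s) - (∑ i, ω i) / s * F ((∑ i, ω i) / s))
        ∂(Measure.pi fun _ => μ) =
      (∫ ω : Fin (m + 1) → ℝ, ((∑ i, (1 - τ (ω i))) / (m + 1)) ^ 2 * deriv F ((∑ i, ω i) / s)
        ∂(Measure.pi fun _ => μ)) +
      (m + 1 : ℝ)⁻¹ * (m + 1 : ℝ)⁻¹ * (∑ i, ∫ ω : Fin (m + 1) → ℝ,
        (1 - τ (ω i)) * τ (ω i) * deriv F ((∑ i, ω i) / s) ∂(Measure.pi fun _ => μ)) -
      (m + 1 : ℝ)⁻¹ * s⁻¹ * ∑ i, ∫ ω : Fin (m + 1) → ℝ,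
        (1 - τ (ω i)) * ω i * F ((∑ i, ω i) / s) ∂(Measure.pi fun _ => μ) := by
  have hFc := hF.continuous
  have hm : (m : ℝ) + 1 ≠ 0 := by positivity
  have hx1 : Integrable (fun x => x) μ := hx.integrable (by norm_num)
  have hτ1 : Integrable τ μ := hτ.integrable (by norm_num)
  have hu : MemLp (fun x => 1 - τ x) 2 μ := (memLp_const 1).sub hτ
  have iu : ∀ i, MemLp (fun ω : Fin (m + 1) → ℝ => 1 - τ (ω i)) 2 (Measure.pi fun _ => μ) :=
    fun i => memLp_pi_eval i hu
  have c : ∀ i j, Integrable (fun ω : Fin (m + 1) → ℝ => (1 - τ (ω i)) * ω j * F ((∑ i, ω i) / s))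
      (Measure.pi fun _ => μ) := fun i j =>
    ((iu i).integrable_mul (memLp_pi_eval j hx)).mul_bdd (by fun_prop) (ae_of_all _ fun ω => hB _)
  have d : ∀ i j, Integrable (fun ω : Fin (m + 1) → ℝ =>
      (1 - τ (ω i)) * τ (ω j) * deriv F ((∑ i, ω i) / s)) (Measure.pi fun _ => μ) := fun i j =>
    ((iu i).integrable_mul (memLp_pi_eval j hτ)).mul_bdd (by fun_prop) (ae_of_all _ fun ω => hB' _)
  have iU : MemLp (fun ω : Fin (m + 1) → ℝ => (∑ i, (1 - τ (ω i))) / (m + 1)) 2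
      (Measure.pi fun _ => μ) := by
    simp only [div_eq_inv_mul]
    exact (memLp_finsetSum _ fun i _ => iu i).const_mul _
  have iU2 : Integrable (fun ω : Fin (m + 1) → ℝ =>
      ((∑ i, (1 - τ (ω i))) / (m + 1)) ^ 2 * deriv F ((∑ i, ω i) / s)) (Measure.pi fun _ => μ) :=
    iU.integrable_sq.mul_bdd (by fun_prop) (ae_of_all _ fun ω => hB' _)
  have key : ∀ i j, i ≠ j → ∫ ω : Fin (m + 1) → ℝ, (1 - τ (ω i)) * ω j * F ((∑ i, ω i) / s)
      ∂(Measure.pi fun _ => μ) = s⁻¹ * ∫ ω : Fin (m + 1) → ℝ,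
        (1 - τ (ω i)) * τ (ω j) * deriv F ((∑ i, ω i) / s) ∂(Measure.pi fun _ => μ) := by
    intro i j hij
    obtain ⟨k, rfl⟩ := Fin.exists_succAbove_eq hij
    simpa only [mul_assoc] using integral_pi_stein h hx1 hτ1 hF hF' hB hB' s j
      (A := fun y => 1 - τ (y k)) (integrable_pi_eval k (hu.integrable (by norm_num)))
  have e : ∀ ω : Fin (m + 1) → ℝ, (∑ i, (1 - τ (ω i))) / (m + 1) *
        (deriv F ((∑ i, ω i) / s) - (∑ i, ω i) / s * F ((∑ i, ω i) / s)) =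
      ((∑ i, (1 - τ (ω i))) / (m + 1)) ^ 2 * deriv F ((∑ i, ω i) / s) +
      (m + 1 : ℝ)⁻¹ * (m + 1 : ℝ)⁻¹ *
        (∑ i, ∑ j, (1 - τ (ω i)) * τ (ω j) * deriv F ((∑ i, ω i) / s)) -
      (m + 1 : ℝ)⁻¹ * s⁻¹ * ∑ i, ∑ j, (1 - τ (ω i)) * ω j * F ((∑ i, ω i) / s) := by
    intro ω
    simp only [← Finset.sum_mul, ← Finset.mul_sum]
    have : ∑ j, τ (ω j) = (m + 1) - ∑ i, (1 - τ (ω i)) := by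
      rw [Finset.sum_sub_distrib]
      simp
    rw [this]
    field_simp
    ring
  have id2 := integrable_finsetSum Finset.univ fun i _ =>
    integrable_finsetSum Finset.univ fun j _ => d i j
  have ic2 := integrable_finsetSum Finset.univ fun i _ =>
    integrable_finsetSum Finset.univ fun j _ => c i j
  simp only [e]
  rw [integral_sub (by exact iU2.add (id2.const_mul _)) (ic2.const_mul _),
    integral_add iU2 (id2.const_mul _), integral_const_mul, integral_const_mul,
    integral_finsetSum _ fun i _ => integrable_finsetSum Finset.univ fun j _ => d i j,
    integral_finsetSum _ fun i _ => integrable_finsetSum Finset.univ fun j _ => c i j]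
  simp only [fun i => integral_finsetSum Finset.univ fun j (_ : j ∈ Finset.univ) => d i j,
    fun i => integral_finsetSum Finset.univ fun j (_ : j ∈ Finset.univ) => c i j]
  set dd : Fin (m + 1) → Fin (m + 1) → ℝ := fun i j => ∫ ω : Fin (m + 1) → ℝ,
        (1 - τ (ω i)) * τ (ω j) * deriv F ((∑ i, ω i) / s) ∂(Measure.pi fun _ => μ) with hdd
  set cc : Fin (m + 1) → Fin (m + 1) → ℝ := fun i j => ∫ ω : Fin (m + 1) → ℝ,
        (1 - τ (ω i)) * ω j * F ((∑ i, ω i) / s) ∂(Measure.pi fun _ => μ) with hcc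
  have hsum : ∀ i, ∑ j, cc i j = s⁻¹ * (∑ j, dd i j) + cc i i - s⁻¹ * dd i i := fun i => by
    have := Finset.sum_eq_single (s := Finset.univ) (f := fun j => cc i j - s⁻¹ * dd i j) i
      (fun j _ hj => sub_eq_zero.2 (key i j hj.symm)) (by simp)
    rw [Finset.sum_sub_distrib, ← Finset.mul_sum] at this
    linarith
  change _ + (m + 1 : ℝ)⁻¹ * (m + 1 : ℝ)⁻¹ * (∑ i, ∑ j, dd i j) -
      (m + 1 : ℝ)⁻¹ * s⁻¹ * ∑ i, ∑ j, cc i j =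
    _ + (m + 1 : ℝ)⁻¹ * (m + 1 : ℝ)⁻¹ * (∑ i, dd i i) - (m + 1 : ℝ)⁻¹ * s⁻¹ * ∑ i, cc i i
  simp only [hsum, Finset.sum_sub_distrib, Finset.sum_add_distrib, ← Finset.mul_sum]
  have hss : s⁻¹ * s⁻¹ = (m + 1 : ℝ)⁻¹ := by rw [← hs, sq, mul_inv]
  linear_combination (m + 1 : ℝ)⁻¹ * ((∑ i, dd i i) - ∑ i, ∑ j, dd i j) * hss

lemma integral_pi_sq_mean {μ : Measure ℝ} [IsProbabilityMeasure μ] {u : ℝ → ℝ}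
    (hu : MemLp u 2 μ) (h0 : ∫ x, u x ∂μ = 0) (m : ℕ) :
    ∫ ω : Fin (m + 1) → ℝ, ((∑ i, u (ω i)) / (m + 1)) ^ 2 ∂(Measure.pi fun _ => μ) =
      (∫ x, u x ^ 2 ∂μ) / (m + 1) := by
  have h := variance_sum_pi (μ := fun _ : Fin (m + 1) => μ) (X := fun _ => u) fun _ => hu
  have hi : ∀ i : Fin (m + 1), Integrable (fun ω : Fin (m + 1) → ℝ => u (ω i))
      (Measure.pi fun _ => μ) := fun i => integrable_pi_eval i (hu.integrable (by norm_num))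
  rw [variance_of_integral_eq_zero, variance_of_integral_eq_zero hu.aemeasurable h0] at h
  · simp only [Finset.sum_apply, Finset.sum_const, Finset.card_univ, Fintype.card_fin,
      nsmul_eq_mul] at h
    simp only [div_pow]
    rw [integral_div, h]
    push_cast
    field_simp
  · exact Finset.aemeasurable_sum _ fun i _ => (hi i).aemeasurable
  · simp only [Finset.sum_apply]
    rw [integral_finsetSum _ fun i _ => hi i]
    simp [integral_pi_eval _ hu.aestronglyMeasurable, h0]

lemma abs_integral_mul_le {α : Type*} [MeasurableSpace α] {P : Measure α} {p q : α → ℝ} {B : ℝ}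
    (hp : Integrable p P) (hq : ∀ ω, |q ω| ≤ B) :
    |∫ ω, p ω * q ω ∂P| ≤ B * ∫ ω, |p ω| ∂P := by
  rw [← integral_const_mul, ← Real.norm_eq_abs]
  refine norm_integral_le_of_norm_le (hp.abs.const_mul B) (ae_of_all _ fun ω => ?_)
  rw [Real.norm_eq_abs, abs_mul, mul_comm]
  exact mul_le_mul_of_nonneg_right (hq ω) (abs_nonneg _)

lemma one_le_integral_pow_four {μ : Measure ℝ} [IsProbabilityMeasure μ]
    (h2 : ∫ x, x ^ 2 ∂μ = 1) (h4 : Integrable (fun x => x ^ 4) μ) : 1 ≤ ∫ x, x ^ 4 ∂μ := by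
  have ix2 := (integrable_of_integrable_pow_four h4).2.1.integrable_sq
  have e : ∫ x, (x ^ 2 - 1) ^ 2 ∂μ = (∫ x, x ^ 4 ∂μ) - 1 := by
    have : ∀ x : ℝ, (x ^ 2 - 1) ^ 2 = (x ^ 4 - 2 * x ^ 2) + 1 := fun x => by ring
    simp only [this]
    rw [integral_add (by exact h4.sub (ix2.const_mul 2)) (integrable_const _),
      integral_sub h4 (ix2.const_mul 2), integral_const_mul, h2]
    simp
    ring
  exact sub_nonneg.1 (e ▸ integral_nonneg fun x => sq_nonneg _)

lemma sq_integral_pow_three_le {μ : Measure ℝ} [IsProbabilityMeasure μ]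
    (h2 : ∫ x, x ^ 2 ∂μ = 1) (h4 : Integrable (fun x => x ^ 4) μ) :
    (∫ x, x ^ 3 ∂μ) ^ 2 ≤ ∫ x, x ^ 4 ∂μ := by
  obtain ⟨-, x2, i3⟩ := integrable_of_integrable_pow_four h4
  have i3' : Integrable (fun x => x ^ 3) μ := i3.mono' (by fun_prop) (ae_of_all _ fun x => by simp)
  set γ := ∫ x, x ^ 3 ∂μ with hγ
  have e : ∫ x, (x ^ 2 - γ * x) ^ 2 ∂μ = (∫ x, x ^ 4 ∂μ) - γ ^ 2 := by
    have : ∀ x : ℝ, (x ^ 2 - γ * x) ^ 2 = (x ^ 4 - 2 * γ * x ^ 3) + γ ^ 2 * x ^ 2 :=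
      fun x => by ring
    simp only [this]
    rw [integral_add (by exact h4.sub (i3'.const_mul (2 * γ))) (x2.integrable_sq.const_mul _),
      integral_sub h4 (i3'.const_mul (2 * γ)), integral_const_mul, integral_const_mul, h2, ← hγ]
    ring
  exact sub_nonneg.1 (e ▸ integral_nonneg fun x => sq_nonneg _)

lemma abs_integral_coord_mul_le {μ : Measure ℝ} [IsProbabilityMeasure μ] {ι : Type*} [Fintype ι]
    (i : ι) {a : ℝ → ℝ} (ha : Integrable a μ) {q : (ι → ℝ) → ℝ} {B : ℝ} (hq : ∀ ω, |q ω| ≤ B) :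
    |∫ ω, a (ω i) * q ω ∂(Measure.pi fun _ => μ)| ≤ B * ∫ x, |a x| ∂μ := by
  have h := abs_integral_mul_le (integrable_pi_eval i ha) hq
  rwa [integral_pi_eval i (a := fun x => |a x|) ha.abs.aestronglyMeasurable] at h

lemma integral_one_sub_steinKernel_sq {μ : Measure ℝ} [IsProbabilityMeasure μ] {τ : ℝ → ℝ}
    (hτ : MemLp τ 2 μ) (mτ : ∫ x, τ x ∂μ = 1) :
    ∫ x, (1 - τ x) ^ 2 ∂μ = (∫ x, τ x ^ 2 ∂μ) - 1 := by
  have hτ1 : Integrable τ μ := hτ.integrable (by norm_num)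
  have : ∀ x, (1 - τ x) ^ 2 = (τ x ^ 2 - 2 * τ x) + 1 := fun x => by ring
  simp only [this]
  rw [integral_add (by exact hτ.integrable_sq.sub (hτ1.const_mul 2)) (integrable_const _),
    integral_sub hτ.integrable_sq (hτ1.const_mul 2), integral_const_mul, mτ]
  simp
  ring

/-- A diagonal term is close to its factorized counterpart. -/
lemma abs_integral_coord_add_le {μ : Measure ℝ} [IsProbabilityMeasure μ] {τ : ℝ → ℝ} {γ : ℝ}
    (h2 : ∫ x, x ^ 2 ∂μ = 1) (hγ : ∫ x, x ^ 3 ∂μ = γ) (h4 : Integrable (fun x => x ^ 4) μ)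
    (hS : IsSteinKernel μ 0 τ) (hτ : MemLp τ 2 μ)
    {F : ℝ → ℝ} (hF : Differentiable ℝ F) {B : ℝ} (hB : ∀ x, |F x| ≤ B)
    (hB' : ∀ x, |deriv F x| ≤ B) {s : ℝ} (hs : 0 < s) {m : ℕ} (i : Fin (m + 1)) :
    |(∫ ω, (1 - τ (ω i)) * ω i * F ((∑ i, ω i) / s) ∂(Measure.pi fun _ => μ)) +
        γ / 2 * ∫ ω : Fin (m + 1) → ℝ, F ((∑ i, ω i) / s) ∂(Measure.pi fun _ => μ)| ≤
      B / s * ((∫ x, τ x ^ 2 ∂μ) / 2 + ∫ x, x ^ 4 ∂μ) := by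
  have hFc := hF.continuous
  have hB0 : 0 ≤ B := (abs_nonneg _).trans (hB 0)
  obtain ⟨ix, x2, -⟩ := integrable_of_integrable_pow_four h4
  have ix2 := x2.integrable_sq
  have hτ1 : Integrable τ μ := hτ.integrable (by norm_num)
  have hu : MemLp (fun x => 1 - τ x) 2 μ := (memLp_const 1).sub hτ
  have iτx : Integrable (fun x => τ x * x) μ := hτ.integrable_mul x2
  have iux : Integrable (fun x => (1 - τ x) * x) μ := hu.integrable_mul x2
  have hV := integral_one_sub_steinKernel_sq hτ ((integral_steinKernel_eq hS h4 hτ1).trans h2)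
  have mτx : 2 * ∫ x, τ x * x ∂μ = γ := (two_mul_integral_steinKernel_mul_eq hS h4 hτ).trans hγ
  have ib3 : Integrable (fun x => (1 - τ x) * x + γ / 2) μ := iux.add (integrable_const _)
  have ib0 : ∫ x, ((1 - τ x) * x + γ / 2) ∂μ = 0 := by
    have hx0 : ∫ x, x ∂μ = 0 := by
      simpa using hS.2 (fun _ => 1) (by fun_prop) ⟨1, by simp⟩ ⟨0, by simp⟩ (by simpa using ix)
        (by simp)
    rw [integral_add iux (integrable_const _)]
    simp only [sub_mul, one_mul]
    rw [integral_sub ix iτx, hx0]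
    simp
    linarith
  have hdom : ∀ x, |((1 - τ x) * x + γ / 2) * x| ≤
      ((1 - τ x) ^ 2 + x ^ 4) / 2 + (x ^ 2 + γ ^ 2) / 4 := fun x => by
    rw [abs_le]
    constructor <;> nlinarith [sq_nonneg (1 - τ x + x ^ 2), sq_nonneg (1 - τ x - x ^ 2),
      sq_nonneg (x - γ), sq_nonneg (x + γ)]
  have id1 : Integrable (fun x => ((1 - τ x) ^ 2 + x ^ 4) / 2) μ :=
    (hu.integrable_sq.add h4).div_const 2
  have id2 : Integrable (fun x => (x ^ 2 + γ ^ 2) / 4) μ :=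
    (ix2.add (integrable_const _)).div_const 4
  have ibx : Integrable (fun x => ((1 - τ x) * x + γ / 2) * x) μ :=
    (id1.add id2).mono' (ib3.aestronglyMeasurable.mul (by fun_prop)) (ae_of_all _ hdom)
  have i1 : Integrable (fun ω : Fin (m + 1) → ℝ => (1 - τ (ω i)) * ω i * F ((∑ i, ω i) / s))
      (Measure.pi fun _ => μ) :=
    (integrable_pi_eval i iux).mul_bdd (by fun_prop) (ae_of_all _ fun ω => hB _)
  have i2 : Integrable (fun ω : Fin (m + 1) → ℝ => F ((∑ i, ω i) / s))
      (Measure.pi fun _ => μ) := Integrable.of_bound (by fun_prop) B (ae_of_all _ fun ω => hB _)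
  rw [← integral_const_mul, ← integral_add i1 (i2.const_mul _)]
  simp only [← add_mul]
  refine (abs_integral_pi_coord_le ib3 ib0 ibx hF hB hB' hs i).trans ?_
  gcongr
  have := integral_mono ibx.abs (id1.add id2) hdom
  simp only [Pi.add_apply] at this
  rw [integral_add id1 id2, integral_div, integral_div,
    integral_add hu.integrable_sq h4, integral_add ix2 (integrable_const _), hV, h2] at this
  simp only [integral_const, probReal_univ, one_smul] at this
  have hγM := hγ ▸ sq_integral_pow_three_le h2 h4
  have hM1 : 1 ≤ ∫ x, x ^ 4 ∂μ := one_le_integral_pow_four h2 h4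
  linarith

set_option maxHeartbeats 1000000 in
/-- The two-term expansion for continuous test functions. -/
lemma edgeworth_bound_of_continuous {μ : Measure ℝ} [IsProbabilityMeasure μ] {τ : ℝ → ℝ}
    (h2 : ∫ x, x ^ 2 ∂μ = 1) (h4 : Integrable (fun x => x ^ 4) μ)
    (hS : IsSteinKernel μ 0 τ) (hτ2 : Integrable (fun x => τ x ^ 2) μ)
    {h : ℝ → ℝ} (hh : Continuous h) (hB : ∀ x, |h x| ≤ 1) {m : ℕ} {s γ : ℝ} (hs0 : 0 < s)
    (hs : s ^ 2 = m + 1) (hγ : ∫ x, x ^ 3 ∂μ = γ) :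
    |(∫ ω : Fin (m + 1) → ℝ, h ((∑ i, ω i) / s) ∂(Measure.pi fun _ => μ)) -
        (∫ z, h z ∂(gaussianReal 0 1)) -
        γ / (6 * s) * ∫ z, (z ^ 3 - 3 * z) * h z ∂(gaussianReal 0 1)| ≤
      100 / (m + 1) * ((∫ x, x ^ 4 ∂μ) + ∫ x, τ x ^ 2 ∂μ) := by
  have hm : (0 : ℝ) < m + 1 := by positivity
  obtain ⟨ix, x2, -⟩ := integrable_of_integrable_pow_four h4
  have hτ : MemLp τ 2 μ := (memLp_two_iff_integrable_sq hS.1.aestronglyMeasurable).2 hτ2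
  have hτ1 : Integrable τ μ := hτ.integrable (by norm_num)
  have hu : MemLp (fun x => 1 - τ x) 2 μ := (memLp_const 1).sub hτ
  have iuτ : Integrable (fun x => (1 - τ x) * τ x) μ := hu.integrable_mul hτ
  have mτ : ∫ x, τ x ∂μ = 1 := (integral_steinKernel_eq hS h4 hτ1).trans h2
  have mu0 : ∫ x, (1 - τ x) ∂μ = 0 := by
    rw [integral_sub (integrable_const _) hτ1, mτ]; simp
  set M := ∫ x, x ^ 4 ∂μ
  set Q := ∫ x, τ x ^ 2 ∂μ
  have hV : ∫ x, (1 - τ x) ^ 2 ∂μ = Q - 1 := integral_one_sub_steinKernel_sq hτ mτ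
  have hQ0 : 0 ≤ Q := integral_nonneg fun x => sq_nonneg _
  have hM1 : 1 ≤ M := one_le_integral_pow_four h2 h4
  have hγM : γ ^ 2 ≤ M := hγ ▸ sq_integral_pow_three_le h2 h4
  obtain ⟨f, fd, fc, fB, fB', fs⟩ := exists_stein_solution hh hB
  obtain ⟨F, Fd, Fc, FB, FB', Fs⟩ := exists_stein_solution fc fB'
  obtain ⟨G, Gd, Gc, GB, GB', Gs⟩ := exists_stein_solution Fd.continuous FB
  norm_num at fB fB' FB FB' GB GB'
  have hFc := Fd.continuous
  have hfF := integral_iterated_stein_solution (B := 24) hh (fun z => (hB z).trans (by norm_num)) fd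
    fc (fun z => (fB z).trans (by norm_num)) (fun z => (fB' z).trans (by norm_num)) fs Fd FB Fs
  set P : Measure (Fin (m + 1) → ℝ) := Measure.pi fun _ => μ
  set W : (Fin (m + 1) → ℝ) → ℝ := fun ω => (∑ i, ω i) / s
  set U : (Fin (m + 1) → ℝ) → ℝ := fun ω => (∑ i, (1 - τ (ω i))) / (m + 1) with hU
  have hWm : Measurable W := by fun_prop
  have hU2 : MemLp U 2 P := by
    simp only [hU, div_eq_inv_mul]
    exact (memLp_finsetSum _ fun i _ => memLp_pi_eval i hu).const_mul _
  have hU1 : Integrable U P := hU2.integrable (by norm_num)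
  have hUsq : ∫ ω, U ω ^ 2 ∂P = (Q - 1) / (m + 1) := by
    rw [← hV]
    exact integral_pi_sq_mean hu mu0 m
  have hU0 : ∫ ω, U ω ∂P = 0 := by
    simp only [hU]
    rw [integral_div, integral_finsetSum _ fun i _ =>
      integrable_pi_eval i (hu.integrable (by norm_num))]
    simp only [fun i => integral_pi_eval (ι := Fin (m + 1)) i hu.aestronglyMeasurable, mu0]
    simp
  have ib : ∀ {q : ℝ → ℝ} {B : ℝ}, Continuous q → (∀ x, |q x| ≤ B) →
      Integrable (fun ω => q (W ω)) P := fun {q B} hq hqB =>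
    Integrable.of_bound (hq.measurable.comp hWm).aestronglyMeasurable B
      (ae_of_all _ fun ω => hqB _)
  -- the Stein equation turns both discrepancies into weighted means
  have E1 : (∫ ω, h (W ω) ∂P) - ∫ z, h z ∂(gaussianReal 0 1) =
      ∫ ω, U ω * (deriv F (W ω) - W ω * F (W ω)) ∂P := by
    have e1 := integral_deriv_sub_mul_pi hS ix hτ1 fd fc (B := 6) fB
      (fun x => (fB' x).trans (by norm_num)) hs
    have e2 : ∫ ω, (deriv f (W ω) - W ω * f (W ω)) ∂P =
        (∫ ω, h (W ω) ∂P) - ∫ z, h z ∂(gaussianReal 0 1) := by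
      simp only [fs]
      rw [integral_sub (ib hh hB) (integrable_const _)]
      simp
    rw [← e2]
    refine e1.trans ?_
    have iUf : Integrable (fun ω => U ω * deriv f (W ω)) P :=
      hU1.mul_bdd (fc.measurable.comp hWm).aestronglyMeasurable (ae_of_all _ fun ω => fB' _)
    simp only [Fs, mul_sub]
    rw [integral_sub iUf (hU1.mul_const _), integral_mul_const, hU0, zero_mul, sub_zero]
  have E2 : (∫ ω, F (W ω) ∂P) - ∫ z, F z ∂(gaussianReal 0 1) = ∫ ω, U ω * deriv G (W ω) ∂P := by
    have e1 := integral_deriv_sub_mul_pi hS ix hτ1 Gd Gc (B := 144) GB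
      (fun x => (GB' x).trans (by norm_num)) hs
    have e2 : ∫ ω, (deriv G (W ω) - W ω * G (W ω)) ∂P =
        (∫ ω, F (W ω) ∂P) - ∫ z, F z ∂(gaussianReal 0 1) := by
      simp only [Gs]
      rw [integral_sub (ib hFc FB) (integrable_const _)]
      simp
    rw [← e2]
    exact e1
  have E3 := integral_mul_deriv_sub_mul_pi hS x2 hτ Fd Fc (B := 24) FB
    (fun x => (FB' x).trans (by norm_num)) hs
  set a1 := ∫ ω, U ω ^ 2 * deriv F (W ω) ∂P
  set a2 : Fin (m + 1) → ℝ := fun i => ∫ ω, (1 - τ (ω i)) * τ (ω i) * deriv F (W ω) ∂P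
  set a3 : Fin (m + 1) → ℝ := fun i => ∫ ω, (1 - τ (ω i)) * ω i * F (W ω) ∂P
  change ∫ ω, U ω * (deriv F (W ω) - W ω * F (W ω)) ∂P =
    a1 + (m + 1 : ℝ)⁻¹ * (m + 1 : ℝ)⁻¹ * (∑ i, a2 i) - (m + 1 : ℝ)⁻¹ * s⁻¹ * ∑ i, a3 i at E3
  have b1 : |a1| ≤ 16 * (Q - 1) / (m + 1) := by
    refine (abs_integral_mul_le hU2.integrable_sq fun ω => FB' _).trans_eq ?_
    simp only [abs_sq]
    rw [hUsq, mul_div_assoc]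
  have b2 : ∀ i, |a2 i| ≤ 16 * Q := by
    intro i
    have h1 := abs_integral_coord_mul_le i iuτ (q := fun ω => deriv F (W ω)) fun ω => FB' _
    have h2 : ∫ x, |(1 - τ x) * τ x| ∂μ ≤ ∫ x, ((1 - τ x) ^ 2 + τ x ^ 2) / 2 ∂μ := by
      refine integral_mono iuτ.abs ((hu.integrable_sq.add hτ2).div_const 2) fun x => ?_
      simp only [abs_le]
      constructor <;> nlinarith [sq_nonneg (1 - τ x + τ x), sq_nonneg (1 - τ x - τ x)]
    rw [integral_div, integral_add hu.integrable_sq hτ2, hV] at h2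
    exact h1.trans (by linarith)
  have b3 : ∀ i, |a3 i + γ / 2 * ∫ ω, F (W ω) ∂P| ≤ 24 / s * (Q / 2 + M) := fun i =>
    abs_integral_coord_add_le h2 hγ h4 hS hτ Fd FB
      (fun x => (FB' x).trans (by norm_num)) hs0 i
  have b4 : |γ / (2 * s) * ((∫ ω, F (W ω) ∂P) - ∫ z, F z ∂(gaussianReal 0 1))| ≤
      24 * (M + Q) / (m + 1) := by
    rw [E2, abs_mul]
    have h1 := abs_integral_mul_le hU1 (q := fun ω => deriv G (W ω)) fun ω => GB' _
    have h2 : |γ / (2 * s)| * (96 * ∫ ω, |U ω| ∂P) ≤ ∫ ω, 24 * (γ ^ 2 / (m + 1) + U ω ^ 2) ∂P := by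
      rw [← mul_assoc, ← integral_const_mul]
      refine integral_mono (hU1.abs.const_mul _)
        (((integrable_const _).add hU2.integrable_sq).const_mul _) fun ω => ?_
      simp only
      rw [← hs, abs_div, abs_of_pos (by positivity : 0 < 2 * s)]
      have e : |γ| / (2 * s) * 96 * |U ω| = 48 * ((|γ| / s) * |U ω|) := by field_simp; ring
      have e' : γ ^ 2 / s ^ 2 = (|γ| / s) ^ 2 := by rw [div_pow, sq_abs]
      rw [e, e', ← sq_abs (U ω)]
      nlinarith [sq_nonneg (|γ| / s - |U ω|)]
    rw [integral_const_mul, integral_add (integrable_const _) hU2.integrable_sq, hUsq] at h2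
    simp only [integral_const, probReal_univ, one_smul] at h2
    refine (mul_le_mul_of_nonneg_left h1 (abs_nonneg _)).trans (h2.trans ?_)
    rw [← add_div, ← mul_div_assoc]
    gcongr
    linarith
  have b2s : |(m + 1 : ℝ)⁻¹ * (m + 1 : ℝ)⁻¹ * ∑ i, a2 i| ≤ 16 * Q / (m + 1) := by
    have : |∑ i, a2 i| ≤ (m + 1) * (16 * Q) := by
      refine (Finset.abs_sum_le_sum_abs _ _).trans ((Finset.sum_le_sum fun i _ => b2 i).trans_eq ?_)
      simp
    rw [abs_mul, abs_of_pos (by positivity)]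
    calc _ ≤ (m + 1 : ℝ)⁻¹ * (m + 1 : ℝ)⁻¹ * ((m + 1) * (16 * Q)) := by gcongr
      _ = _ := by field_simp
  have b3s : |(m + 1 : ℝ)⁻¹ * s⁻¹ * (∑ i, a3 i) + γ / (2 * s) * ∫ ω, F (W ω) ∂P| ≤
      24 * (Q / 2 + M) / (m + 1) := by
    have e : (m + 1 : ℝ)⁻¹ * s⁻¹ * (∑ i, a3 i) + γ / (2 * s) * ∫ ω, F (W ω) ∂P =
        (m + 1 : ℝ)⁻¹ * s⁻¹ * ∑ i, (a3 i + γ / 2 * ∫ ω, F (W ω) ∂P) := by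
      rw [Finset.sum_add_distrib]
      simp only [Finset.sum_const, Finset.card_univ, Fintype.card_fin, nsmul_eq_mul]
      push_cast
      field_simp
    have : |∑ i, (a3 i + γ / 2 * ∫ ω, F (W ω) ∂P)| ≤ (m + 1) * (24 / s * (Q / 2 + M)) := by
      refine (Finset.abs_sum_le_sum_abs _ _).trans ((Finset.sum_le_sum fun i _ => b3 i).trans_eq ?_)
      simp
    rw [e, abs_mul, abs_of_pos (by positivity)]
    calc _ ≤ (m + 1 : ℝ)⁻¹ * s⁻¹ * ((m + 1) * (24 / s * (Q / 2 + M))) := by gcongr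
      _ = _ := by rw [← hs]; field_simp
  have hfin : (∫ ω, h (W ω) ∂P) - (∫ z, h z ∂(gaussianReal 0 1)) -
      γ / (6 * s) * (∫ z, (z ^ 3 - 3 * z) * h z ∂(gaussianReal 0 1)) =
      a1 + (m + 1 : ℝ)⁻¹ * (m + 1 : ℝ)⁻¹ * (∑ i, a2 i) -
      ((m + 1 : ℝ)⁻¹ * s⁻¹ * (∑ i, a3 i) + γ / (2 * s) * ∫ ω, F (W ω) ∂P) +
      γ / (2 * s) * ((∫ ω, F (W ω) ∂P) - ∫ z, F z ∂(gaussianReal 0 1)) := by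
    rw [E1, E3, ← hfF]
    field_simp
    ring
  rw [hfin]
  have hle : 16 * (Q - 1) / (m + 1) + 16 * Q / (m + 1) + 24 * (Q / 2 + M) / (m + 1) +
      24 * (M + Q) / (m + 1) ≤ 100 / (m + 1) * (M + Q) := by
    rw [← add_div, ← add_div, ← add_div, div_mul_eq_mul_div]
    gcongr
    linarith
  refine ((abs_add_le _ _).trans (add_le_add ((abs_sub _ _).trans
    (add_le_add ((abs_add_le _ _).trans (add_le_add b1 b2s)) b3s)) b4)).trans hle

/-- A bounded measurable function is almost everywhere the limit of continuous functions
with the same bound. -/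
lemma exists_continuous_tendsto_ae {ν : Measure ℝ} [IsFiniteMeasure ν] {h : ℝ → ℝ}
    (hh : Measurable h) (hB : ∀ x, |h x| ≤ 1) :
    ∃ g : ℕ → ℝ → ℝ, (∀ k, Continuous (g k)) ∧ (∀ k x, |g k x| ≤ 1) ∧
      ∀ᵐ x ∂ν, Tendsto (fun k => g k x) atTop (nhds (h x)) := by
  have hL : MemLp h 1 ν := MemLp.of_bound hh.aestronglyMeasurable 1 (ae_of_all _ hB)
  have hg : ∀ k : ℕ, ∃ g : BoundedContinuousFunction ℝ ℝ,
      eLpNorm (h - ⇑g) 1 ν ≤ ((k : ℝ≥0∞) + 1)⁻¹ ∧ MemLp g 1 ν := fun k =>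
    hL.exists_boundedContinuous_eLpNorm_sub_le (by simp) (by simp)
  choose g hg hgL using hg
  have ht : Tendsto (fun k => eLpNorm (⇑(g k) - h) 1 ν) atTop (nhds 0) := by
    have hinv : Tendsto (fun k : ℕ => ((k : ℝ≥0∞) + 1)⁻¹) atTop (nhds 0) := by
      have := ENNReal.tendsto_inv_nat_nhds_zero.comp (tendsto_add_atTop_nat 1)
      simpa [Function.comp_def] using this
    refine tendsto_of_tendsto_of_tendsto_of_le_of_le tendsto_const_nhds hinv
      (fun k => zero_le) fun k => ?_
    simp only
    rw [eLpNorm_sub_comm]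
    exact hg k
  obtain ⟨ns, -, hns⟩ := (tendstoInMeasure_of_tendsto_eLpNorm one_ne_zero
    (fun k => (hgL k).aestronglyMeasurable) hh.aestronglyMeasurable ht).exists_seq_tendsto_ae
  refine ⟨fun k x => max (-1) (min 1 (g (ns k) x)), fun k => ?_, fun k x => ?_, ?_⟩
  · have := (g (ns k)).continuous
    fun_prop
  · exact abs_le.2 ⟨le_max_left _ _, max_le (by norm_num) (min_le_left _ _)⟩
  · filter_upwards [hns] with x hx
    have hc : Continuous fun t : ℝ => max (-1) (min 1 t) := by fun_prop
    have := (hc.tendsto (h x)).comp hx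
    rwa [min_eq_right (abs_le.1 (hB x)).2, max_eq_right (abs_le.1 (hB x)).1] at this

/-- The two-term expansion for measurable test functions. -/
lemma edgeworth_bound {μ : Measure ℝ} [IsProbabilityMeasure μ] {τ : ℝ → ℝ}
    (h2 : ∫ x, x ^ 2 ∂μ = 1) (h4 : Integrable (fun x => x ^ 4) μ)
    (hS : IsSteinKernel μ 0 τ) (hτ2 : Integrable (fun x => τ x ^ 2) μ)
    {h : ℝ → ℝ} (hh : Measurable h) (hB : ∀ x, |h x| ≤ 1) {m : ℕ} {s γ : ℝ} (hs0 : 0 < s)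
    (hs : s ^ 2 = m + 1) (hγ : ∫ x, x ^ 3 ∂μ = γ) :
    |(∫ ω : Fin (m + 1) → ℝ, h ((∑ i, ω i) / s) ∂(Measure.pi fun _ => μ)) -
        (∫ z, h z ∂(gaussianReal 0 1)) -
        γ / (6 * s) * ∫ z, (z ^ 3 - 3 * z) * h z ∂(gaussianReal 0 1)| ≤
      100 / (m + 1) * ((∫ x, x ^ 4 ∂μ) + ∫ x, τ x ^ 2 ∂μ) := by
  set P : Measure (Fin (m + 1) → ℝ) := Measure.pi fun _ => μ
  have hW : Measurable fun ω : Fin (m + 1) → ℝ => (∑ i, ω i) / s := by fun_prop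
  obtain ⟨g, gc, gB, gt⟩ := exists_continuous_tendsto_ae
    (ν := P.map (fun ω => (∑ i, ω i) / s) + gaussianReal 0 1) hh hB
  rw [ae_add_measure_iff] at gt
  have t1 : Tendsto (fun k => ∫ ω, g k ((∑ i, ω i) / s) ∂P) atTop
      (nhds (∫ ω, h ((∑ i, ω i) / s) ∂P)) :=
    tendsto_integral_of_dominated_convergence (fun _ => 1)
      (fun k => ((gc k).measurable.comp hW).aestronglyMeasurable) (integrable_const _)
      (fun k => ae_of_all _ fun ω => gB k _) (ae_of_ae_map hW.aemeasurable gt.1)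
  have t2 : Tendsto (fun k => ∫ z, g k z ∂(gaussianReal 0 1)) atTop
      (nhds (∫ z, h z ∂(gaussianReal 0 1))) :=
    tendsto_integral_of_dominated_convergence (fun _ => 1)
      (fun k => (gc k).aestronglyMeasurable) (integrable_const _)
      (fun k => ae_of_all _ fun ω => gB k _) gt.2
  have i1 : Integrable (fun z : ℝ => z) (gaussianReal 0 1) := by
    simpa using integrable_pow_gaussianReal 1
  have t3 : Tendsto (fun k => ∫ z, (z ^ 3 - 3 * z) * g k z ∂(gaussianReal 0 1)) atTop
      (nhds (∫ z, (z ^ 3 - 3 * z) * h z ∂(gaussianReal 0 1))) := by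
    refine tendsto_integral_of_dominated_convergence (fun z => |z ^ 3 - 3 * z|) (fun k => ?_)
      ((integrable_pow_gaussianReal 3).sub (i1.const_mul 3)).abs
      (fun k => ae_of_all _ fun z => ?_) ?_
    · have := gc k
      exact Continuous.aestronglyMeasurable (by fun_prop)
    · rw [Real.norm_eq_abs, abs_mul]
      exact mul_le_of_le_one_right (abs_nonneg _) (gB k z)
    · filter_upwards [gt.2] with z hz using hz.const_mul _
  exact le_of_tendsto ((t1.sub t2).sub (t3.const_mul _)).abs (Eventually.of_forall fun k =>
    edgeworth_bound_of_continuous h2 h4 hS hτ2 (gc k) (gB k) hs0 hs hγ)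

end SteinEdgeworth

/-- **Stein kernel bound (two-term Edgeworth expansion).**
If the law `μ` of the i.i.d. summands has mean `0`, variance `1`, third moment `γ`, finite
fourth moment, and a nonnegative Stein kernel `τ₁` with `E[τ₁(X₁)²] < ∞`, then for every
test function `h` bounded by `1`, the two-term Edgeworth expansion holds with error
`(C/n)(E[X₁⁴] + E[τ₁(X₁)²])` for a universal constant `C`. -/
theorem stein_kernel_edgeworth_bound :
    ∃ C : ℝ, ∀ n : ℕ, 1 ≤ n →
      ∀ (μ : Measure ℝ), IsProbabilityMeasure μ →
      ∀ γ : ℝ,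
      (∫ x, x ∂μ) = 0 → (∫ x, x ^ 2 ∂μ) = 1 → (∫ x, x ^ 3 ∂μ) = γ →
      Integrable (fun x => x ^ 4) μ →
      ∀ τ₁ : ℝ → ℝ, IsSteinKernel μ 0 τ₁ → (∀ x, 0 ≤ τ₁ x) →
      Integrable (fun x => (τ₁ x) ^ 2) μ →
      ∀ h : ℝ → ℝ, Measurable h → (∀ x, |h x| ≤ 1) →
      |(∫ ω, h ((∑ i, ω i) / Real.sqrt n) ∂(Measure.pi fun _ : Fin n => μ)) -
          (∫ z, h z ∂(gaussianReal 0 1)) -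
          γ / (6 * Real.sqrt n) * ∫ z, (z ^ 3 - 3 * z) * h z ∂(gaussianReal 0 1)|
        ≤ C / n * ((∫ x, x ^ 4 ∂μ) + ∫ x, (τ₁ x) ^ 2 ∂μ) := by
  refine ⟨100, ?_⟩
  intro n hn μ _ γ _ h2 h3 h4 τ hS _ hτ2 h hh hB
  obtain ⟨m, rfl⟩ := Nat.exists_eq_succ_of_ne_zero (Nat.one_le_iff_ne_zero.1 hn)
  have hm : (0 : ℝ) < ((m.succ : ℕ) : ℝ) := by positivity
  have := SteinEdgeworth.edgeworth_bound h2 h4 hS hτ2 hh hB (Real.sqrt_pos.2 hm)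
    ((Real.sq_sqrt hm.le).trans (Nat.cast_succ m)) h3
  rwa [← Nat.cast_succ m] at this
end

section
/- Let n ≥ 1 and let X_1, …, X_n be i.i.d. real random variables with E[X_1] = 0 and E[X_1^2] = 1, and suppose X_1 has a Stein kernel τ_1 with E[τ_1(X_1)^2] < ∞. Let W = (X_1 + … + X_n)/√n and Z ~ N(0,1). Then for every measurable h : ℝ → ℝ with ‖h‖_∞ < ∞, |E[h(W)] − E[h(Z)]| ≤ (2/√n)·‖h − E[h(Z)]‖_∞·√(E[τ_1(X_1)^2]). -/
open MeasureTheory ProbabilityTheory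
open scoped ENNReal

open Filter Topology Set

/-- The Gaussian weight `x e^{-x²/2}` integrates over `(w, ∞)` to `e^{-w²/2}`. -/
lemma integral_Ioi_mul_exp_neg_half_sq (w : ℝ) :
    ∫ x in Ioi w, x * Real.exp (-(1 / 2) * x ^ 2) = Real.exp (-(1 / 2) * w ^ 2) := by
  have hd : ∀ x ∈ Ici w, HasDerivAt (fun x : ℝ => -Real.exp (-(1 / 2) * x ^ 2))
      (x * Real.exp (-(1 / 2) * x ^ 2)) x := fun x _ => by
    refine ((hasDerivAt_pow 2 x).const_mul (-(1 / 2) : ℝ)).exp.fun_neg.congr_deriv ?_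
    push_cast
    ring
  have ht : Tendsto (fun x : ℝ => -Real.exp (-(1 / 2) * x ^ 2)) atTop (𝓝 0) := by
    rw [← neg_zero]
    refine (Real.tendsto_exp_atBot.comp ?_).neg
    exact (tendsto_pow_atTop two_ne_zero).const_mul_atTop_of_neg (by norm_num)
  rw [integral_Ioi_of_hasDerivAt_of_tendsto' hd
    (integrable_mul_exp_neg_mul_sq (by norm_num)).integrableOn ht]
  simp

/-- Mills-type bound for the upper Gaussian tail of a bounded function. -/
lemma mul_abs_integral_Ioi_mul_exp_le {g : ℝ → ℝ} {K : ℝ} (hK : ∀ x, |g x| ≤ K)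
    {w : ℝ} (hw : 0 ≤ w) :
    w * |∫ x in Ioi w, g x * Real.exp (-(1 / 2) * x ^ 2)| ≤
      K * Real.exp (-(1 / 2) * w ^ 2) := by
  rw [← integral_Ioi_mul_exp_neg_half_sq w, ← integral_const_mul]
  nth_rewrite 1 [← abs_of_nonneg hw]
  rw [← abs_mul, ← integral_const_mul, ← Real.norm_eq_abs]
  refine norm_integral_le_of_norm_le
    ((integrable_mul_exp_neg_mul_sq (b := 1 / 2) (by norm_num)).const_mul K).integrableOn ?_
  filter_upwards [ae_restrict_mem measurableSet_Ioi] with x hx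
  have hx' : w ≤ x := le_of_lt hx
  have hK0 := (abs_nonneg _).trans (hK x)
  rw [Real.norm_eq_abs, abs_mul, abs_mul, abs_of_nonneg hw, Real.abs_exp]
  calc w * (|g x| * Real.exp (-(1 / 2) * x ^ 2))
      ≤ x * (K * Real.exp (-(1 / 2) * x ^ 2)) := by
        gcongr
        · exact hw.trans hx'
        · exact hK x
    _ = _ := by ring

/-- Stein's equation `f' - w f = g` for a continuous, bounded, Gaussian-centred `g` has a bounded
solution with `|w f(w)| ≤ ‖g‖_∞`. -/
lemma exists_stein_solution {g : ℝ → ℝ} (hg : Continuous g) {K : ℝ} (hK : ∀ x, |g x| ≤ K)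
    (h0 : ∫ z, g z ∂(gaussianReal 0 1) = 0) :
    ∃ f : ℝ → ℝ, (∀ w, HasDerivAt f (w * f w + g w) w) ∧ (∃ M, ∀ w, |f w| ≤ M) ∧
      ∀ w, |w * f w| ≤ K := by
  set p : ℝ → ℝ := fun x => g x * Real.exp (-(1 / 2) * x ^ 2) with hp
  have hpc : Continuous p := by fun_prop
  have hpi : Integrable p :=
    (integrable_exp_neg_mul_sq (by norm_num)).bdd_mul hg.aestronglyMeasurable
      (ae_of_all _ hK)
  have hp0 : ∫ x, p x = 0 := by
    rw [integral_gaussianReal_eq_integral_smul one_ne_zero] at h0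
    have : ∀ x, gaussianPDFReal 0 1 x • g x = (√(2 * Real.pi))⁻¹ * p x := fun x => by
      simp only [gaussianPDFReal, hp, smul_eq_mul, NNReal.coe_one, mul_one, sub_zero]
      rw [show -x ^ 2 / 2 = -(1 / 2) * x ^ 2 by ring]
      ring
    simp_rw [this, integral_const_mul] at h0
    exact (mul_eq_zero.1 h0).resolve_left (by positivity)
  set G : ℝ → ℝ := fun w => ∫ x in Iic w, p x with hG
  have hGd : ∀ w, HasDerivAt G (p w) w := fun w => by
    have : G = fun u => G 0 + ∫ x in (0 : ℝ)..u, p x := by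
      ext u
      rw [← intervalIntegral.integral_Iic_sub_Iic hpi.integrableOn hpi.integrableOn]
      simp [hG]
    rw [this]
    exact (intervalIntegral.integral_hasDerivAt_right (hpc.intervalIntegrable _ _)
      (hpc.stronglyMeasurableAtFilter _ _) hpc.continuousAt).const_add _
  have hGb : ∀ w, |w| * |G w| ≤ K * Real.exp (-(1 / 2) * w ^ 2) := fun w => by
    rcases le_total 0 w with hw | hw
    · have h1 := intervalIntegral.integral_Iic_add_Ioi (b := w) hpi.integrableOn hpi.integrableOn
      have h2 : G w = -∫ x in Ioi w, p x := by rw [hp0] at h1; exact eq_neg_of_add_eq_zero_left h1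
      rw [h2, abs_neg, abs_of_nonneg hw]
      exact mul_abs_integral_Ioi_mul_exp_le hK hw
    · have h1 := mul_abs_integral_Ioi_mul_exp_le (g := fun x => g (-x)) (fun x => hK (-x))
        (neg_nonneg.2 hw)
      have h2 := integral_comp_neg_Ioi (-w) p
      simp only [hp, neg_sq, neg_neg] at h1 h2
      rw [h2] at h1
      rwa [abs_of_nonpos hw]
  set f : ℝ → ℝ := fun w => Real.exp (1 / 2 * w ^ 2) * G w with hf
  have hfd : ∀ w, HasDerivAt f (w * f w + g w) w := fun w => by
    refine (((hasDerivAt_pow 2 w).const_mul (1 / 2 : ℝ)).exp.fun_mul (hGd w)).congr_deriv ?_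
    have : Real.exp (1 / 2 * w ^ 2) * Real.exp (-(1 / 2) * w ^ 2) = 1 := by
      rw [← Real.exp_add]; simp
    simp only [hf, hp]
    push_cast
    linear_combination g w * this
  have hfb : ∀ w, |w * f w| ≤ K := fun w => by
    have : Real.exp (1 / 2 * w ^ 2) * Real.exp (-(1 / 2) * w ^ 2) = 1 := by
      rw [← Real.exp_add]; simp
    rw [abs_mul, hf, abs_mul, Real.abs_exp]
    calc |w| * (Real.exp (1 / 2 * w ^ 2) * |G w|)
        = Real.exp (1 / 2 * w ^ 2) * (|w| * |G w|) := by ring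
      _ ≤ Real.exp (1 / 2 * w ^ 2) * (K * Real.exp (-(1 / 2) * w ^ 2)) :=
          mul_le_mul_of_nonneg_left (hGb w) (Real.exp_pos _).le
      _ = K := by linear_combination K * this
  refine ⟨f, hfd, ?_, hfb⟩
  have hfc : Continuous f := continuous_iff_continuousAt.2 fun w => (hfd w).continuousAt
  obtain ⟨C, hC⟩ := (isCompact_Icc (a := (-1 : ℝ)) (b := 1)).exists_bound_of_continuousOn
    hfc.continuousOn
  refine ⟨max C K, fun w => ?_⟩
  by_cases hw : |w| ≤ 1
  · exact (hC w (abs_le.1 hw)).trans (le_max_left _ _)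
  · refine le_trans ?_ ((hfb w).trans (le_max_right _ _))
    rw [abs_mul w]
    exact le_mul_of_one_le_left (abs_nonneg _) (not_le.1 hw).le

/-- An integrable Stein kernel of a law with second moment one has mean one. -/
lemma IsSteinKernel.integral_eq_one {μ : Measure ℝ} [IsProbabilityMeasure μ] {τ : ℝ → ℝ}
    (hτ : IsSteinKernel μ 0 τ) (hτi : Integrable τ μ) (hvar : ∫ x, x ^ 2 ∂μ = 1) :
    ∫ x, τ x ∂μ = 1 := by
  have hx2 : Integrable (fun x : ℝ => x ^ 2) μ := by
    by_contra hc
    simp [integral_undef hc] at hvar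
  set F : ℕ → ℝ → ℝ := fun k x => (k + 1) * Real.sin (x / (k + 1)) with hF
  have hd : ∀ k x, HasDerivAt (F k) (Real.cos (x / (k + 1))) x := fun k x => by
    have hk : (k + 1 : ℝ) ≠ 0 := by positivity
    refine (((hasDerivAt_id' x).div_const (k + 1 : ℝ)).sin.const_mul (k + 1 : ℝ)).congr_deriv ?_
    field_simp
  have hFx : ∀ k x, |F k x| ≤ |x| := fun k x => by
    have hk : (0 : ℝ) < k + 1 := by positivity
    rw [hF, abs_mul, abs_of_pos hk]
    calc (k + 1 : ℝ) * |Real.sin (x / (k + 1))| ≤ (k + 1) * |x / (k + 1)| := 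
          mul_le_mul_of_nonneg_left Real.abs_sin_le_abs hk.le
      _ = |x| := by rw [abs_div, abs_of_pos hk]; field_simp
  have hFm : ∀ k, Measurable (F k) := fun k => by fun_prop
  have hbd : ∀ k, ∀ᵐ x ∂μ, ‖x * F k x‖ ≤ x ^ 2 := fun k => ae_of_all _ fun x => by
    rw [norm_mul, ← sq_abs, sq]
    exact mul_le_mul_of_nonneg_left (hFx k x) (abs_nonneg _)
  have hbd' : ∀ k : ℕ, ∀ᵐ x ∂μ, ‖τ x * Real.cos (x / (k + 1))‖ ≤ ‖τ x‖ :=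
    fun k => ae_of_all _ fun x => by
      rw [norm_mul]
      exact mul_le_of_le_one_right (norm_nonneg _) (Real.abs_cos_le_one _)
  have hm1 : ∀ k, AEStronglyMeasurable (fun x => x * F k x) μ := fun k =>
    (measurable_id.mul (hFm k)).aestronglyMeasurable
  have hm2 : ∀ k : ℕ, AEStronglyMeasurable (fun x => τ x * Real.cos (x / (k + 1))) μ := fun k =>
    (hτ.1.mul (by fun_prop)).aestronglyMeasurable
  have key : ∀ k : ℕ, ∫ x, x * F k x ∂μ = ∫ x, τ x * Real.cos (x / (k + 1)) ∂μ := fun k => by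
    have hde : deriv (F k) = fun x => Real.cos (x / (k + 1)) := funext fun x => (hd k x).deriv
    have := hτ.2 (F k) (fun x => (hd k x).differentiableAt) ⟨k + 1, fun x => ?_⟩
      ⟨1, fun x => ?_⟩ ?_ ?_
    · simpa [hde] using this
    · rw [hF, abs_mul, abs_of_pos (by positivity : (0 : ℝ) < k + 1)]
      exact mul_le_of_le_one_right (by positivity) (Real.abs_sin_le_one _)
    · rw [hde]; exact Real.abs_cos_le_one _
    · simpa using hx2.mono' (hm1 k) (hbd k)
    · rw [hde]; exact hτi.norm.mono' (hm2 k) (hbd' k)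
  have h0 : ∀ x : ℝ, Tendsto (fun k : ℕ => x / ((k : ℝ) + 1)) atTop (𝓝 0) := fun x => by
    simpa [div_eq_mul_inv] using (tendsto_one_div_add_atTop_nhds_zero_nat (𝕜 := ℝ)).const_mul x
  have hlimτ : Tendsto (fun k : ℕ => ∫ x, τ x * Real.cos (x / (k + 1)) ∂μ) atTop
      (𝓝 (∫ x, τ x ∂μ)) := by
    refine tendsto_integral_of_dominated_convergence _ hm2 hτi.norm hbd' (ae_of_all _ fun x => ?_)
    simpa using ((Real.continuous_cos.tendsto 0).comp (h0 x)).const_mul (τ x)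
  have hlimx : Tendsto (fun k : ℕ => ∫ x, x * F k x ∂μ) atTop (𝓝 (∫ x, x ^ 2 ∂μ)) := by
    refine tendsto_integral_of_dominated_convergence _ hm1 hx2 hbd (ae_of_all _ fun x => ?_)
    have hs : ∀ k : ℕ, F k x = x * Real.sinc (x / (k + 1)) := fun k => by
      have hk : (k + 1 : ℝ) ≠ 0 := by positivity
      rcases eq_or_ne x 0 with rfl | hx0
      · simp [hF]
      · rw [Real.sinc_of_ne_zero (div_ne_zero hx0 hk)]
        simp only [hF]
        field_simp
    simp_rw [hs, sq]
    simpa using (((Real.continuous_sinc.tendsto 0).comp (h0 x)).const_mul x).const_mul x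
  simp_rw [key] at hlimx
  rw [tendsto_nhds_unique hlimτ hlimx, hvar]

/-- The Stein identity for one coordinate of an i.i.d. sample, tested against a function of a
multiple of the sum. -/
lemma IsSteinKernel.integral_eval_mul_comp_sum {μ : Measure ℝ} [IsProbabilityMeasure μ] {τ : ℝ → ℝ}
    (hτ : IsSteinKernel μ 0 τ) (hτi : Integrable τ μ) (hx : Integrable (fun x : ℝ => x) μ)
    {f : ℝ → ℝ} (hf : Differentiable ℝ f) {M M' : ℝ} (hM : ∀ x, |f x| ≤ M)
    (hM' : ∀ x, |deriv f x| ≤ M') (c : ℝ) {n : ℕ} (i : Fin n) :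
    ∫ ω, ω i * f ((∑ j, ω j) * c) ∂(Measure.pi fun _ : Fin n => μ) =
      c * ∫ ω, τ (ω i) * deriv f ((∑ j, ω j) * c) ∂(Measure.pi fun _ : Fin n => μ) := by
  obtain _ | n := n
  · exact i.elim0
  have hf' := measurable_deriv f
  have hfm := hf.continuous.measurable
  have hτm := hτ.1
  have mp := (measurePreserving_piFinSuccAbove (fun _ : Fin (n + 1) => μ) i).symm
  set e := (MeasurableEquiv.piFinSuccAbove (fun _ : Fin (n + 1) => ℝ) i).symm
  have hei : ∀ z, e z i = z.1 := fun z => by simp [e]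
  have hes : ∀ z, ∑ j, e z j = z.1 + ∑ j, z.2 j := fun z => by
    rw [Fin.sum_univ_succAbove _ i]; simp [e]
  rw [← mp.integral_comp e.measurableEmbedding, ← mp.integral_comp e.measurableEmbedding]
  simp_rw [hei, hes]
  have hfst : Integrable (fun z : ℝ × (Fin n → ℝ) => z.1)
      (μ.prod (Measure.pi fun _ : Fin n => μ)) := hx.comp_fst _
  have hτfst : Integrable (fun z : ℝ × (Fin n → ℝ) => τ z.1)
      (μ.prod (Measure.pi fun _ : Fin n => μ)) := hτi.comp_fst _
  rw [integral_prod_symm, integral_prod_symm, ← integral_const_mul]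
  · refine integral_congr_ae (ae_of_all _ fun y => ?_)
    set s := ∑ j, y j
    have hd : ∀ x, HasDerivAt (fun x => f ((x + s) * c)) (deriv f ((x + s) * c) * c) x := fun x =>
      (hf _).hasDerivAt.comp x (by simpa using ((hasDerivAt_id x).add_const s).mul_const c)
    have hde : deriv (fun x => f ((x + s) * c)) = fun x => deriv f ((x + s) * c) * c :=
      funext fun x => (hd x).deriv
    have := hτ.2 (fun x => f ((x + s) * c)) (fun x => (hd x).differentiableAt) ⟨M, fun x => hM _⟩
      ⟨M' * |c|, fun x => ?_⟩ ?_ ?_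
    · rw [hde] at this
      simp only [sub_zero] at this
      simp only []
      rw [this, ← integral_const_mul]
      congr 1 with x
      ring
    · rw [hde, abs_mul]
      exact mul_le_mul_of_nonneg_right (hM' _) (abs_nonneg _)
    · simp only [sub_zero]
      exact hx.mul_bdd (Measurable.aestronglyMeasurable (by fun_prop)) (ae_of_all _ fun x => hM _)
    · rw [hde]
      refine hτi.mul_bdd (c := M' * |c|) (Measurable.aestronglyMeasurable (by fun_prop)) (ae_of_all _ fun x => ?_)
      rw [norm_mul]
      exact mul_le_mul_of_nonneg_right (hM' _) (abs_nonneg _)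
  · exact hτfst.mul_bdd (Measurable.aestronglyMeasurable (by fun_prop)) (ae_of_all _ fun x => hM' _)
  · exact hfst.mul_bdd (Measurable.aestronglyMeasurable (by fun_prop)) (ae_of_all _ fun x => hM _)

/-- `E|1 - S̄| ≤ √(E[τ²] / n)` for the mean `S̄` of `n` i.i.d. copies of a variable `τ` of mean one. -/
lemma integral_abs_one_sub_average_le {μ : Measure ℝ} [IsProbabilityMeasure μ] {τ : ℝ → ℝ}
    (hτ : MemLp τ 2 μ) (h1 : ∫ x, τ x ∂μ = 1) {n : ℕ} (hn : n ≠ 0) :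
    ∫ ω, |1 - (∑ i, τ (ω i)) / n| ∂(Measure.pi fun _ : Fin n => μ) ≤
      Real.sqrt (∫ x, (τ x) ^ 2 ∂μ) / Real.sqrt n := by
  have hn' : (n : ℝ) ≠ 0 := by exact_mod_cast hn
  set P := Measure.pi fun _ : Fin n => μ
  have hL : ∀ i : Fin n, MemLp (fun ω : Fin n → ℝ => τ (ω i)) 2 P := fun i =>
    hτ.comp_measurePreserving (measurePreserving_eval _ i)
  set S : (Fin n → ℝ) → ℝ := fun ω => (∑ i, τ (ω i)) / n with hS
  have hSL : MemLp S 2 P := by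
    simpa only [hS, div_eq_mul_inv] using (memLp_finsetSum _ fun i _ => hL i).mul_const _
  have hSm : ∫ ω, S ω ∂P = 1 := by
    simp only [hS]
    rw [integral_div, integral_finsetSum _ fun i _ => (hL i).integrable (by norm_num)]
    simp_rw [P, integral_comp_eval (μ := fun _ : Fin n => μ) hτ.aestronglyMeasurable, h1]
    simp [hn']
  have hSv : variance S P = variance τ μ / n := by
    have h := variance_sum_pi (μ := fun _ : Fin n => μ) (X := fun _ => τ) (fun _ => hτ)
    have : S = fun ω => (∑ i, fun ω : Fin n → ℝ => τ (ω i)) ω * (n : ℝ)⁻¹ := by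
      ext ω; simp [hS, div_eq_mul_inv]
    rw [this, variance_mul_const, h]
    simp
    field_simp
  set Y : (Fin n → ℝ) → ℝ := fun ω => |1 - S ω| with hY
  have hYL : MemLp Y 2 P := ((memLp_const 1).sub hSL).abs
  have hY2 : ∫ ω, Y ω ^ 2 ∂P = variance S P := by
    rw [variance_eq_integral hSL.aemeasurable, hSm]
    congr 1 with ω
    rw [hY, sq_abs]; ring
  have hYv := variance_nonneg Y P
  rw [variance_eq_sub hYL] at hYv
  have hτv : variance τ μ ≤ ∫ x, τ x ^ 2 ∂μ := by
    rw [variance_eq_sub hτ]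
    simp only [Pi.pow_apply]
    linarith [sq_nonneg (∫ x, τ x ∂μ)]
  rw [← Real.sqrt_div' _ (Nat.cast_nonneg n)]
  refine Real.le_sqrt_of_sq_le ?_
  simp only [Pi.pow_apply, hY2, hSv] at hYv
  calc (∫ ω, Y ω ∂P) ^ 2 ≤ variance τ μ / n := by linarith
    _ ≤ _ := by gcongr

/-- The first-order bound for continuous test functions. -/
lemma abs_integral_sub_le_of_continuous {n : ℕ} (hn : n ≠ 0) {μ : Measure ℝ}
    [IsProbabilityMeasure μ] (hvar : ∫ x, x ^ 2 ∂μ = 1) {τ : ℝ → ℝ} (hτ : IsSteinKernel μ 0 τ)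
    (hτ2 : Integrable (fun x => (τ x) ^ 2) μ) {g : ℝ → ℝ} (hg : Continuous g) {K : ℝ}
    (hK : ∀ x, |g x - ∫ z, g z ∂(gaussianReal 0 1)| ≤ K) :
    |(∫ ω, g ((∑ i, ω i) / Real.sqrt n) ∂(Measure.pi fun _ : Fin n => μ)) -
        ∫ z, g z ∂(gaussianReal 0 1)|
      ≤ 2 / Real.sqrt n * K * Real.sqrt (∫ x, (τ x) ^ 2 ∂μ) := by
  have hτL : MemLp τ 2 μ := (memLp_two_iff_integrable_sq hτ.1.aestronglyMeasurable).2 hτ2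
  have hτi : Integrable τ μ := hτL.integrable (by norm_num)
  have hx2 : Integrable (fun x : ℝ => x ^ 2) μ := by
    by_contra hc
    simp [integral_undef hc] at hvar
  have hx : Integrable (fun x : ℝ => x) μ :=
    ((memLp_two_iff_integrable_sq (f := fun x : ℝ => x)
      measurable_id.aestronglyMeasurable).2 hx2).integrable (by norm_num)
  have h1 := hτ.integral_eq_one hτi hvar
  set m := ∫ z, g z ∂(gaussianReal 0 1) with hm
  have hgb : ∀ x, ‖g x‖ ≤ K + |m| := fun x => by
    have := abs_add_le (g x - m) m
    rw [sub_add_cancel] at this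
    rw [Real.norm_eq_abs]
    linarith [hK x]
  have hgi : ∀ {ν : Measure ℝ} [IsFiniteMeasure ν], Integrable g ν := fun {ν} _ =>
    Integrable.of_bound hg.aestronglyMeasurable (K + |m|) (ae_of_all _ hgb)
  obtain ⟨f, hfd, ⟨M, hM⟩, hwf⟩ := exists_stein_solution (g := fun x => g x - m) (by fun_prop) hK
    (by rw [integral_sub hgi (integrable_const _)]; simp [hm])
  have hf : Differentiable ℝ f := fun w => (hfd w).differentiableAt
  have hdf : ∀ w, deriv f w = w * f w + (g w - m) := fun w => (hfd w).deriv
  have hM' : ∀ w, |deriv f w| ≤ 2 * K := fun w => by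
    rw [hdf]
    exact (abs_add_le _ _).trans (by linarith [hwf w, hK w])
  set P := Measure.pi fun _ : Fin n => μ
  set c : ℝ := (Real.sqrt n)⁻¹ with hc
  set W : (Fin n → ℝ) → ℝ := fun ω => (∑ i, ω i) * c with hW
  have hWm : Measurable W := by fun_prop
  have hf' := measurable_deriv f
  have hfm := hf.continuous.measurable
  have hcc : c * c = (n : ℝ)⁻¹ := by
    rw [hc, ← mul_inv, Real.mul_self_sqrt (Nat.cast_nonneg n)]
  have hxi : ∀ i, Integrable (fun ω : Fin n → ℝ => ω i * f (W ω)) P := fun i =>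
    (integrable_comp_eval (μ := fun _ : Fin n => μ) hx).mul_bdd (Measurable.aestronglyMeasurable (by fun_prop))
      (ae_of_all _ fun ω => hM _)
  have hτd : ∀ i, Integrable (fun ω : Fin n → ℝ => τ (ω i) * deriv f (W ω)) P := fun i =>
    (integrable_comp_eval (μ := fun _ : Fin n => μ) hτi).mul_bdd (Measurable.aestronglyMeasurable (by fun_prop))
      (ae_of_all _ fun ω => hM' _)
  have hfW : Integrable (fun ω => deriv f (W ω)) P :=
    Integrable.of_bound (Measurable.aestronglyMeasurable (by fun_prop)) (2 * K) (ae_of_all _ fun ω => hM' _)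
  have hWf : Integrable (fun ω => W ω * f (W ω)) P :=
    Integrable.of_bound (Measurable.aestronglyMeasurable (by fun_prop)) K (ae_of_all _ fun ω => hwf _)
  have hstein : ∫ ω, W ω * f (W ω) ∂P = ∫ ω, (∑ i, τ (ω i)) / n * deriv f (W ω) ∂P := by
    have e1 : ∀ ω, W ω * f (W ω) = c * ∑ i, ω i * f (W ω) := fun ω => by
      rw [← Finset.sum_mul]; simp only [hW]; ring
    have e2 : ∀ ω : Fin n → ℝ, (∑ i, τ (ω i)) / n * deriv f (W ω) =
        (c * c) * ∑ i, τ (ω i) * deriv f (W ω) := fun ω => by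
      rw [← Finset.sum_mul, hcc]; ring
    simp_rw [e1, e2, integral_const_mul]
    rw [integral_finsetSum _ fun i _ => hxi i, integral_finsetSum _ fun i _ => hτd i, mul_assoc]
    congr 1
    rw [Finset.mul_sum]
    exact Finset.sum_congr rfl fun i _ => hτ.integral_eval_mul_comp_sum hτi hx hf hM hM' c i
  have hSi : Integrable (fun ω : Fin n → ℝ => (∑ i, τ (ω i)) / n) P :=
    (integrable_finsetSum _ fun i _ =>
      integrable_comp_eval (μ := fun _ : Fin n => μ) hτi).div_const _
  have hmain : (∫ ω, g (W ω) ∂P) - m =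
      ∫ ω, (1 - (∑ i, τ (ω i)) / n) * deriv f (W ω) ∂P := by
    have e3 : ∀ ω : Fin n → ℝ, (1 - (∑ i, τ (ω i)) / n) * deriv f (W ω) =
        deriv f (W ω) - (∑ i, τ (ω i)) / n * deriv f (W ω) := fun ω => by ring
    have e4 : ∀ ω, g (W ω) = deriv f (W ω) - W ω * f (W ω) + m := fun ω => by rw [hdf]; ring
    simp_rw [e3]
    rw [integral_sub hfW (hSi.mul_bdd (Measurable.aestronglyMeasurable (by fun_prop)) (ae_of_all _ fun ω => hM' _)), ← hstein]
    simp_rw [e4]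
    rw [integral_add _ (integrable_const _), integral_sub hfW hWf]
    · simp
    · exact hfW.sub hWf
  simp_rw [div_eq_mul_inv _ (Real.sqrt n)]
  change |(∫ ω, g (W ω) ∂P) - m| ≤ _
  rw [hmain]
  have hK0 : 0 ≤ K := (abs_nonneg _).trans (hK 0)
  calc |∫ ω, (1 - (∑ i, τ (ω i)) / n) * deriv f (W ω) ∂P|
      ≤ ∫ ω, |1 - (∑ i, τ (ω i)) / n| * (2 * K) ∂P := by
        rw [← Real.norm_eq_abs]
        refine norm_integral_le_of_norm_le ?_ (ae_of_all _ fun ω => ?_)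
        · exact ((integrable_const _).sub hSi).abs.mul_const _
        · rw [norm_mul]
          exact mul_le_mul_of_nonneg_left (hM' _) (abs_nonneg _)
    _ ≤ Real.sqrt (∫ x, (τ x) ^ 2 ∂μ) / Real.sqrt n * (2 * K) := by
        rw [integral_mul_const]
        gcongr
        exact integral_abs_one_sub_average_le hτL h1 hn
    _ = _ := by ring

/-- A bounded measurable function is an `L¹` limit of continuous functions with the same bounds. -/
lemma exists_continuous_integral_abs_sub_le {ν : Measure ℝ} [IsFiniteMeasure ν] {g : ℝ → ℝ}
    (hg : Measurable g) {K : ℝ} (hK : ∀ x, |g x| ≤ K) {ε : ℝ} (hε : 0 < ε) :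
    ∃ u : ℝ → ℝ, Continuous u ∧ (∀ x, |u x| ≤ K) ∧ ∫ x, |g x - u x| ∂ν ≤ ε := by
  have hgi : Integrable g ν := Integrable.of_bound hg.aestronglyMeasurable K (ae_of_all _ hK)
  have hK0 : -K ≤ K := by linarith [(abs_nonneg _).trans (hK 0)]
  obtain ⟨v, hv, hvi⟩ := hgi.exists_boundedContinuous_integral_sub_le hε
  refine ⟨fun x => max (-K) (min K (v x)), by fun_prop, fun x => abs_le.2
    ⟨le_max_left _ _, max_le hK0 (min_le_left _ _)⟩, le_trans ?_ hv⟩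
  refine integral_mono_of_nonneg (ae_of_all _ fun x => abs_nonneg _) (hgi.sub hvi).norm
    (ae_of_all _ fun x => ?_)
  have h1 : g x = max (-K) (min K (g x)) := by
    rw [min_eq_right (abs_le.1 (hK x)).2, max_eq_right (abs_le.1 (hK x)).1]
  change |g x - max (-K) (min K (v x))| ≤ |g x - v x|
  nth_rewrite 1 [h1]
  refine (abs_max_sub_max_le_max _ _ _ _).trans ?_
  refine max_le (by simp) ((abs_min_sub_min_le_max _ _ _ _).trans ?_)
  exact max_le (by simp) le_rfl

/-- **First-order Stein kernel bound.**
If the law `μ` of the i.i.d. summands has mean `0`, variance `1` and a Stein kernel `τ₁` with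
`E[τ₁(X₁)²] < ∞`, then for every bounded measurable test function `h`,
`|E[h(W)] - E[h(Z)]| ≤ (2/√n) ‖h - E[h(Z)]‖_∞ √(E[τ₁(X₁)²])`. -/
theorem first_order_stein_kernel_bound
    (n : ℕ) (hn : 1 ≤ n)
    (μ : Measure ℝ) (hprob : IsProbabilityMeasure μ)
    (hmean : ∫ x, x ∂μ = 0) (hvar : ∫ x, x ^ 2 ∂μ = 1)
    (τ₁ : ℝ → ℝ) (hτ : IsSteinKernel μ 0 τ₁)
    (hτ2 : Integrable (fun x => (τ₁ x) ^ 2) μ)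
    (h : ℝ → ℝ) (hm : Measurable h) (hb : ∃ M, ∀ x, |h x| ≤ M) :
    |(∫ ω, h ((∑ i, ω i) / Real.sqrt n) ∂(Measure.pi fun _ : Fin n => μ)) -
        ∫ z, h z ∂(gaussianReal 0 1)|
      ≤ 2 / Real.sqrt n * (⨆ x, |h x - ∫ z, h z ∂(gaussianReal 0 1)|) *
        Real.sqrt (∫ x, (τ₁ x) ^ 2 ∂μ) := by
  have hn0 : n ≠ 0 := by omega
  obtain ⟨M, hM⟩ := hb
  set m := ∫ z, h z ∂(gaussianReal 0 1) with hmdef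
  set K := ⨆ x, |h x - m| with hKdef
  have hK : ∀ x, |h x - m| ≤ K := fun x => by
    refine le_ciSup (f := fun x => |h x - m|) ⟨M + |m|, ?_⟩ x
    rintro _ ⟨y, rfl⟩
    exact (abs_sub _ _).trans (by linarith [hM y])
  set W : (Fin n → ℝ) → ℝ := fun ω => (∑ i, ω i) / Real.sqrt n with hW
  have hWm : Measurable W := by fun_prop
  set ρ := (Measure.pi fun _ : Fin n => μ).map W with hρ
  have : IsProbabilityMeasure ρ := Measure.isProbabilityMeasure_map hWm.aemeasurable
  have hmap : ∀ u : ℝ → ℝ, Measurable u →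
      ∫ ω, u (W ω) ∂(Measure.pi fun _ : Fin n => μ) = ∫ x, u x ∂ρ := fun u hu =>
    (integral_map hWm.aemeasurable hu.aestronglyMeasurable).symm
  set A := 2 / Real.sqrt n * Real.sqrt (∫ x, (τ₁ x) ^ 2 ∂μ) with hA
  have hA0 : 0 ≤ A := by positivity
  have hbdd : ∀ {ν : Measure ℝ} [IsFiniteMeasure ν] {u : ℝ → ℝ}, Measurable u →
      (∀ x, |u x| ≤ K) → Integrable u ν := fun hu hb =>
    Integrable.of_bound hu.aestronglyMeasurable K (ae_of_all _ hb)
  have hgm : Measurable fun x => h x - m := hm.sub_const m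
  have hh : ∀ {ν : Measure ℝ} [IsProbabilityMeasure ν], ∫ x, (h x - m) ∂ν = (∫ x, h x ∂ν) - m :=
    fun {ν} _ => by
      rw [integral_sub (Integrable.of_bound hm.aestronglyMeasurable M (ae_of_all _ hM))
        (integrable_const _)]
      simp
  have hgoal : |∫ x, (h x - m) ∂ρ| ≤ K * A := by
    refine le_of_forall_pos_le_add fun δ hδ => ?_
    obtain ⟨ε, hε, hεδ⟩ : ∃ ε : ℝ, 0 < ε ∧ ε * (A + 2) ≤ δ :=
      ⟨δ / (A + 2), by positivity, by field_simp; exact le_rfl⟩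
    obtain ⟨u, huc, huK, hu⟩ := exists_continuous_integral_abs_sub_le
      (ν := ρ + gaussianReal 0 1) hgm hK hε
    have hum := huc.measurable
    have hd : ∀ {ν : Measure ℝ} [IsFiniteMeasure ν], Integrable (fun x => |h x - m - u x|) ν :=
      ((hbdd hgm hK).sub (hbdd hum huK)).abs
    rw [integral_add_measure hd hd] at hu
    have hle : ∀ {ν : Measure ℝ} [IsFiniteMeasure ν],
        |(∫ x, (h x - m) ∂ν) - ∫ x, u x ∂ν| ≤ ∫ x, |h x - m - u x| ∂ν := fun {ν} _ => by
      rw [← integral_sub (hbdd hgm hK) (hbdd hum huK)]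
      exact abs_integral_le_integral_abs
    have hρ1 : 0 ≤ ∫ x, |h x - m - u x| ∂ρ := integral_nonneg fun x => abs_nonneg _
    have hγ1 : 0 ≤ ∫ x, |h x - m - u x| ∂(gaussianReal 0 1) :=
      integral_nonneg fun x => abs_nonneg _
    have hr := hle (ν := ρ)
    have hγ := hle (ν := gaussianReal 0 1)
    rw [hh (ν := gaussianReal 0 1), ← hmdef, sub_self, zero_sub, abs_neg] at hγ
    have hmain := abs_integral_sub_le_of_continuous hn0 hvar hτ hτ2 huc
      (K := K + ε) (fun x => (abs_sub _ _).trans (by linarith [huK x]))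
    change |(∫ ω, u (W ω) ∂_) - _| ≤ _ at hmain
    rw [hmap u hum] at hmain
    have hmain' : |(∫ x, u x ∂ρ) - ∫ x, u x ∂(gaussianReal 0 1)| ≤ (K + ε) * A :=
      hmain.trans_eq (by rw [hA]; ring)
    have htri : |∫ x, (h x - m) ∂ρ| ≤ |(∫ x, (h x - m) ∂ρ) - ∫ x, u x ∂ρ| +
        |(∫ x, u x ∂ρ) - ∫ x, u x ∂(gaussianReal 0 1)| + |∫ x, u x ∂(gaussianReal 0 1)| := by
      refine le_trans (le_of_eq ?_) (abs_add_three _ _ _)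
      congr 1
      ring
    nlinarith
  rw [hh] at hgoal
  change |(∫ ω, h (W ω) ∂_) - m| ≤ _
  rw [hmap h hm]
  exact hgoal.trans_eq (by rw [hA]; ring)
end

section
/- Let X_1, …, X_n be i.i.d. real random variables with E[X_1] = 0, Var(X_1) = 1 and E[|X_1|^3] < ∞. Let h : ℝ → ℝ be bounded and measurable, let P : ℝ → ℝ be a polynomial, let σ > 0, let Z ~ N(0,1), and define h_1(x) = E[h(σZ + x)·P(Z)]. Then for every σ_1 ≥ 0, |E[h_1((σ_1/√n)·Σ_{i=1}^n X_i)] − E[h_1(σ_1·Z)]| ≤ C_P·‖h‖_∞·σ_1^3/(σ^3·√n)·E[|X_1|^3 + |Z|^3], where C_P is a constant depending only on the polynomial P. -/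
open MeasureTheory ProbabilityTheory

/-- A polynomial times the Gaussian density is bounded. -/
lemma exists_abs_eval_mul_exp_neg_sq_le (Q : Polynomial ℝ) :
    ∃ C : ℝ, ∀ x : ℝ, |Q.eval x| * Real.exp (-x ^ 2 / 2) ≤ C := by
  induction Q using Polynomial.induction_on' with
  | add p q hp hq =>
    obtain ⟨A, hA⟩ := hp
    obtain ⟨B, hB⟩ := hq
    refine ⟨A + B, fun x => ?_⟩
    have hsum := mul_le_mul_of_nonneg_right (abs_add_le (p.eval x) (q.eval x))
      (Real.exp_nonneg (-x ^ 2 / 2))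
    rw [Polynomial.eval_add]
    linarith [hA x, hB x]
  | monomial k a =>
    refine ⟨|a| * (1 + 2 ^ k * k.factorial), fun x => ?_⟩
    have hfac : (0 : ℝ) < k.factorial := by positivity
    have hpow : (x ^ 2) ^ k ≤ 2 ^ k * k.factorial * Real.exp (x ^ 2 / 2) := by
      have h := Real.pow_div_factorial_le_exp (x ^ 2 / 2) (by positivity) k
      rw [div_le_iff₀ hfac, div_pow, div_le_iff₀ (by positivity)] at h
      linarith
    have hone : 1 ≤ Real.exp (x ^ 2 / 2) := Real.one_le_exp (by positivity)
    have hx : |x| ^ k ≤ 1 + (x ^ 2) ^ k := by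
      rw [← pow_mul, mul_comm 2 k, pow_mul, ← sq_abs (x ^ k), abs_pow]
      nlinarith [sq_nonneg (|x| ^ k - 1), sq_nonneg (|x| ^ k)]
    have hle : |x| ^ k ≤ (1 + 2 ^ k * k.factorial) * Real.exp (x ^ 2 / 2) := by linarith
    have hexp : Real.exp (x ^ 2 / 2) * Real.exp (-x ^ 2 / 2) = 1 := by
      rw [← Real.exp_add]; simp [neg_div]
    calc |(Polynomial.monomial k a).eval x| * Real.exp (-x ^ 2 / 2)
        = |a| * (|x| ^ k * Real.exp (-x ^ 2 / 2)) := by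
          rw [Polynomial.eval_monomial, abs_mul, abs_pow]; ring
      _ ≤ |a| * ((1 + 2 ^ k * k.factorial) * Real.exp (x ^ 2 / 2) * Real.exp (-x ^ 2 / 2)) := by
          gcongr
      _ = |a| * (1 + 2 ^ k * k.factorial) := by rw [mul_assoc (1 + _), hexp, mul_one]

/-- The polynomial `R = X * Q - derivative Q`: the Gaussian density `φ` times `Q` has
derivative `-R * φ`. -/
noncomputable def gaussianAdjointDeriv (Q : Polynomial ℝ) : Polynomial ℝ :=
  Polynomial.X * Q - Polynomial.derivative Q

lemma continuous_gaussianPDFReal_zero_one : Continuous (gaussianPDFReal 0 1) := by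
  unfold gaussianPDFReal
  fun_prop

lemma hasDerivAt_eval_mul_gaussianPDFReal (Q : Polynomial ℝ) (x : ℝ) :
    HasDerivAt (fun x => Q.eval x * gaussianPDFReal 0 1 x)
      (-((gaussianAdjointDeriv Q).eval x * gaussianPDFReal 0 1 x)) x := by
  have hexp : HasDerivAt (fun x : ℝ => Real.exp (-(x - 0) ^ 2 / (2 * ((1 : NNReal) : ℝ))))
      (Real.exp (-(x - 0) ^ 2 / (2 * ((1 : NNReal) : ℝ))) * -x) x := by
    have h := ((((hasDerivAt_id x).sub_const 0).pow 2).neg.div_const (2 * ((1 : NNReal) : ℝ))).exp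
    refine h.congr_deriv ?_
    simp
    ring
  have h := (Q.hasDerivAt x).mul (hexp.const_mul (√(2 * Real.pi * ((1 : NNReal) : ℝ)))⁻¹)
  refine h.congr_deriv ?_
  simp only [gaussianAdjointDeriv, gaussianPDFReal, Polynomial.eval_sub, Polynomial.eval_mul,
    Polynomial.eval_X]
  ring

lemma exists_abs_eval_mul_gaussianPDFReal_le (Q : Polynomial ℝ) :
    ∃ C : ℝ, 0 ≤ C ∧ ∀ x : ℝ, |Q.eval x * gaussianPDFReal 0 1 x| ≤ C * (1 + x ^ 2)⁻¹ := by
  obtain ⟨C, hC⟩ := exists_abs_eval_mul_exp_neg_sq_le ((1 + Polynomial.X ^ 2) * Q)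
  have hC0 : 0 ≤ C := le_trans (by positivity) (hC 0)
  set d : ℝ := (√(2 * Real.pi * ((1 : NNReal) : ℝ)))⁻¹ with hd
  have hd0 : 0 ≤ d := by positivity
  refine ⟨d * C, by positivity, fun x => ?_⟩
  have hx : (0 : ℝ) < 1 + x ^ 2 := by positivity
  have h := hC x
  rw [Polynomial.eval_mul, abs_mul] at h
  simp only [Polynomial.eval_add, Polynomial.eval_one, Polynomial.eval_pow, Polynomial.eval_X,
    abs_of_pos hx] at h
  rw [← div_eq_mul_inv, le_div_iff₀ hx, abs_mul, abs_of_nonneg (gaussianPDFReal_nonneg 0 1 x),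
    gaussianPDFReal, ← hd]
  simp only [sub_zero, NNReal.coe_one, mul_one]
  nlinarith [mul_le_mul_of_nonneg_left h hd0]

lemma integrable_eval_mul_gaussianPDFReal (Q : Polynomial ℝ) :
    Integrable (fun x => Q.eval x * gaussianPDFReal 0 1 x) := by
  obtain ⟨C, -, hC⟩ := exists_abs_eval_mul_gaussianPDFReal_le Q
  exact (integrable_inv_one_add_sq.const_mul C).mono'
    (Q.continuous.mul continuous_gaussianPDFReal_zero_one).aestronglyMeasurable
    (Filter.Eventually.of_forall hC)

/-- The function `t ↦ ∫ k(u) Q(u - t) φ(u - t) du`, a Gaussian smoothing of `k`. -/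
noncomputable def gaussianSmoothing (k : ℝ → ℝ) (Q : Polynomial ℝ) (t : ℝ) : ℝ :=
  ∫ u, k u * (Q.eval (u - t) * gaussianPDFReal 0 1 (u - t))

lemma hasDerivAt_gaussianSmoothing {k : ℝ → ℝ} (hk : Measurable k) {M : ℝ}
    (hM : ∀ x, |k x| ≤ M) (Q : Polynomial ℝ) (t : ℝ) :
    HasDerivAt (gaussianSmoothing k Q) (gaussianSmoothing k (gaussianAdjointDeriv Q) t) t := by
  obtain ⟨C, hC0, hC⟩ := exists_abs_eval_mul_gaussianPDFReal_le (gaussianAdjointDeriv Q)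
  have hM0 : 0 ≤ M := (abs_nonneg _).trans (hM 0)
  have hmeas : ∀ (R : Polynomial ℝ) (s : ℝ), AEStronglyMeasurable
      (fun u => k u * (R.eval (u - s) * gaussianPDFReal 0 1 (u - s))) := fun R s =>
    hk.aestronglyMeasurable.mul
      (((R.continuous.mul continuous_gaussianPDFReal_zero_one).comp
        (continuous_id.sub continuous_const)).aestronglyMeasurable)
  refine (hasDerivAt_integral_of_dominated_loc_of_deriv_le
    (F' := fun s u => k u * ((gaussianAdjointDeriv Q).eval (u - s) * gaussianPDFReal 0 1 (u - s)))
    (bound := fun u => M * (C * (3 * (1 + (u - t) ^ 2)⁻¹)))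
    (Metric.ball_mem_nhds t one_pos) (Filter.Eventually.of_forall fun s => hmeas Q s)
    ?_ (hmeas _ t) ?_ ?_ ?_).2
  · exact ((integrable_eval_mul_gaussianPDFReal Q).comp_sub_right t).bdd_mul
      hk.aestronglyMeasurable (Filter.Eventually.of_forall hM)
  · refine Filter.Eventually.of_forall fun u s hs => ?_
    rw [Real.norm_eq_abs, abs_mul]
    refine mul_le_mul (hM u) ((hC (u - s)).trans (mul_le_mul_of_nonneg_left ?_ hC0))
      (abs_nonneg _) hM0
    rw [← div_eq_mul_inv, le_div_iff₀ (by positivity), inv_mul_eq_div,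
      div_le_iff₀ (by positivity)]
    rw [Metric.mem_ball, Real.dist_eq] at hs
    have hst : (s - t) ^ 2 ≤ 1 := by
      rw [← sq_abs]
      nlinarith [abs_nonneg (s - t)]
    nlinarith [sq_nonneg (u - s - (s - t)), sq_nonneg (u - s)]
  · exact (((integrable_inv_one_add_sq.comp_sub_right t).const_mul 3).const_mul C).const_mul M
  · refine Filter.Eventually.of_forall fun u s _ => ?_
    have h := ((hasDerivAt_eval_mul_gaussianPDFReal Q (u - s)).comp s
      ((hasDerivAt_id s).const_sub u)).const_mul (k u)
    refine h.congr_deriv ?_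
    ring

lemma abs_gaussianSmoothing_le {k : ℝ → ℝ} {M : ℝ} (hM : ∀ x, |k x| ≤ M)
    (Q : Polynomial ℝ) (t : ℝ) :
    |gaussianSmoothing k Q t| ≤ M * ∫ x, |Q.eval x * gaussianPDFReal 0 1 x| := by
  rw [← integral_sub_right_eq_self (fun x => |Q.eval x * gaussianPDFReal 0 1 x|) t,
    ← integral_const_mul]
  rw [gaussianSmoothing, ← Real.norm_eq_abs]
  refine norm_integral_le_of_norm_le (((integrable_eval_mul_gaussianPDFReal Q).abs.comp_sub_right
    t).const_mul M) (Filter.Eventually.of_forall fun u => ?_)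
  rw [Real.norm_eq_abs, abs_mul]
  exact mul_le_mul_of_nonneg_right (hM u) (abs_nonneg _)

lemma integral_eval_mul_gaussianReal_eq_gaussianSmoothing (P : Polynomial ℝ) (h : ℝ → ℝ)
    {σ : ℝ} (hσ : σ ≠ 0) (x : ℝ) :
    ∫ y, P.eval y * h (σ * y + x) ∂(gaussianReal 0 1) =
      gaussianSmoothing (fun u => h (σ * u)) P (σ⁻¹ * x) := by
  rw [integral_gaussianReal_eq_integral_smul one_ne_zero,
    ← integral_sub_right_eq_self (μ := volume) _ (σ⁻¹ * x)]
  refine integral_congr_ae (Filter.Eventually.of_forall fun u => ?_)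
  have hu : σ * (u - σ⁻¹ * x) + x = σ * u := by field_simp; ring
  simp only [smul_eq_mul, hu]
  ring

lemma abs_le_mul_pow_succ_of_hasDerivAt {f f' : ℝ → ℝ} {K : ℝ} {m : ℕ} (hK : 0 ≤ K)
    (hf : ∀ x, HasDerivAt f (f' x) x) (h0 : f 0 = 0) (hb : ∀ x, |f' x| ≤ K * |x| ^ m) (x : ℝ) :
    |f x| ≤ K * |x| ^ (m + 1) := by
  have h := Convex.norm_image_sub_le_of_norm_hasDerivWithin_le (s := Set.Icc (-|x|) |x|)
    (C := K * |x| ^ m) (fun y _ => (hf y).hasDerivWithinAt)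
    (fun y hy => (hb y).trans (by have := abs_le.2 hy; gcongr)) (convex_Icc _ _)
    (x := 0) (y := x) ⟨by simp, by simp⟩ ⟨neg_abs_le x, le_abs_self x⟩
  rw [h0, sub_zero, sub_zero, Real.norm_eq_abs, Real.norm_eq_abs] at h
  rw [pow_succ, ← mul_assoc]
  exact h

lemma abs_integral_le_of_forall_abs_le {Ω : Type*} [MeasurableSpace Ω] {ν : Measure Ω}
    [IsProbabilityMeasure ν] {f : Ω → ℝ} {B : ℝ} (hB : ∀ x, |f x| ≤ B) : |∫ x, f x ∂ν| ≤ B := by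
  have h := norm_integral_le_of_norm_le_const (μ := ν) (f := f) (Filter.Eventually.of_forall hB)
  simpa using h

/-- Taylor expansion to second order with a cubic remainder. -/
lemma abs_taylor_two_remainder_le {f f₁ f₂ f₃ : ℝ → ℝ} {K : ℝ}
    (hf : ∀ x, HasDerivAt f (f₁ x) x) (hf₁ : ∀ x, HasDerivAt f₁ (f₂ x) x)
    (hf₂ : ∀ x, HasDerivAt f₂ (f₃ x) x) (hK : ∀ x, |f₃ x| ≤ K) (a t : ℝ) :
    |f (a + t) - (f a + f₁ a * t + f₂ a / 2 * t ^ 2)| ≤ K * |t| ^ 3 := by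
  have hK0 : 0 ≤ K := (abs_nonneg _).trans (hK 0)
  have hr₂ : ∀ t, |f₂ (a + t) - f₂ a| ≤ K * |t| ^ 1 :=
    abs_le_mul_pow_succ_of_hasDerivAt (f' := fun t => f₃ (a + t)) (m := 0) hK0
      (fun t => ((hf₂ (a + t)).comp_const_add a t).sub_const (f₂ a)) (by simp)
      (fun t => by simpa using hK (a + t))
  have hr₁ : ∀ t, |f₁ (a + t) - (f₁ a + f₂ a * t)| ≤ K * |t| ^ 2 :=
    abs_le_mul_pow_succ_of_hasDerivAt (f' := fun t => f₂ (a + t) - f₂ a) hK0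
      (fun t => (((hf₁ (a + t)).comp_const_add a t).sub
        (((hasDerivAt_id t).const_mul (f₂ a)).const_add (f₁ a))).congr_deriv (by simp))
      (by simp) hr₂
  exact abs_le_mul_pow_succ_of_hasDerivAt (f := fun t => f (a + t) -
      (f a + f₁ a * t + f₂ a / 2 * t ^ 2)) (f' := fun t => f₁ (a + t) - (f₁ a + f₂ a * t)) hK0
    (fun t => (((hf (a + t)).comp_const_add a t).sub
      ((((hasDerivAt_id t).const_mul (f₁ a)).const_add (f a)).add
        (((hasDerivAt_id t).pow 2).const_mul (f₂ a / 2)))).congr_deriv (by simp; ring))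
    (by simp) hr₁ t

lemma abs_integral_comp_sub_taylor_two_le {f f₁ f₂ f₃ : ℝ → ℝ} {B K : ℝ}
    (hf : ∀ x, HasDerivAt f (f₁ x) x) (hf₁ : ∀ x, HasDerivAt f₁ (f₂ x) x)
    (hf₂ : ∀ x, HasDerivAt f₂ (f₃ x) x) (hB : ∀ x, |f x| ≤ B) (hK : ∀ x, |f₃ x| ≤ K)
    {μ : Measure ℝ} [IsProbabilityMeasure μ] (hi₁ : Integrable (fun x => x) μ)
    (hm₁ : ∫ x, x ∂μ = 0) (hm₂ : ∫ x, x ^ 2 ∂μ = 1) (hi₃ : Integrable (fun x => |x| ^ 3) μ)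
    {c : ℝ} (hc : 0 ≤ c) (a : ℝ) :
    |∫ x, f (a + c * x) ∂μ - (f a + f₂ a / 2 * c ^ 2)| ≤ K * c ^ 3 * ∫ x, |x| ^ 3 ∂μ := by
  have hcont : Continuous f := continuous_iff_continuousAt.2 fun x => (hf x).continuousAt
  have hi₂ : Integrable (fun x => x ^ 2) μ := by
    by_contra h
    rw [integral_undef h] at hm₂
    exact zero_ne_one hm₂
  have hif : Integrable (fun x => f (a + c * x)) μ :=
    Integrable.of_bound (by fun_prop) B (Filter.Eventually.of_forall fun x => hB _)
  have hlin : Integrable (fun x => f a + f₁ a * c * x) μ :=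
    (integrable_const _).add (hi₁.const_mul _)
  have hquad : Integrable (fun x => f₂ a / 2 * c ^ 2 * x ^ 2) μ := hi₂.const_mul _
  have hmain : ∫ x, (f a + f₁ a * c * x + f₂ a / 2 * c ^ 2 * x ^ 2) ∂μ =
      f a + f₂ a / 2 * c ^ 2 := by
    rw [integral_add hlin hquad, integral_add (integrable_const _) (hi₁.const_mul _),
      integral_const_mul, integral_const_mul, hm₁, hm₂]
    simp
  have hpoly : Integrable (fun x => f a + f₁ a * c * x + f₂ a / 2 * c ^ 2 * x ^ 2) μ :=
    hlin.add hquad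
  rw [← hmain, ← integral_sub hif hpoly, ← integral_const_mul,
    ← Real.norm_eq_abs (∫ _, _ ∂_)]
  refine norm_integral_le_of_norm_le (hi₃.const_mul _) (Filter.Eventually.of_forall fun x => ?_)
  have h := abs_taylor_two_remainder_le hf hf₁ hf₂ hK a (c * x)
  rw [abs_mul, abs_of_nonneg hc, mul_pow c |x|, ← mul_assoc K] at h
  rw [Real.norm_eq_abs]
  convert h using 2
  ring

lemma integral_gaussianReal_gaussianReal_add {f : ℝ → ℝ} (hf : Continuous f) {B : ℝ}
    (hB : ∀ x, |f x| ≤ B) (b c : ℝ) :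
    ∫ z, ∫ w, f (b * z + c * w) ∂(gaussianReal 0 1) ∂(gaussianReal 0 1) =
      ∫ z, f (√(b ^ 2 + c ^ 2) * z) ∂(gaussianReal 0 1) := by
  have hmap : ∀ (d : ℝ) (g : ℝ → ℝ), Continuous g →
      ∫ z, g (d * z) ∂(gaussianReal 0 1) = ∫ z, g z ∂(gaussianReal 0 (Real.toNNReal (d ^ 2))) := by
    intro d g hg
    have hd := gaussianReal_map_const_mul (μ := 0) (v := 1) d
    have hv : (⟨d ^ 2, sq_nonneg d⟩ : NNReal) * 1 = Real.toNNReal (d ^ 2) := by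
      rw [mul_one]; exact (Real.toNNReal_of_nonneg (sq_nonneg d)).symm
    rw [mul_zero] at hd
    rw [← hv]
    refine Eq.trans ?_ (congrArg (fun ν => ∫ z, g z ∂ν) hd)
    exact (integral_map (by fun_prop) hg.aestronglyMeasurable).symm
  have hinner : ∀ z, ∫ w, f (b * z + c * w) ∂(gaussianReal 0 1) =
      ∫ w, f (b * z + w) ∂(gaussianReal 0 (Real.toNNReal (c ^ 2))) := fun z =>
    hmap c (fun w => f (b * z + w)) (by fun_prop)
  have hcont : Continuous fun z =>
      ∫ w, f (z + w) ∂(gaussianReal 0 (Real.toNNReal (c ^ 2))) :=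
    continuous_of_dominated (bound := fun _ => B) (fun z => by fun_prop)
      (fun z => Filter.Eventually.of_forall fun w => hB _) (integrable_const _)
      (Filter.Eventually.of_forall fun w => by fun_prop)
  simp_rw [hinner]
  rw [hmap b (fun z => ∫ w, f (z + w) ∂(gaussianReal 0 (Real.toNNReal (c ^ 2)))) hcont,
    ← integral_conv (Integrable.of_bound hf.aestronglyMeasurable B
      (Filter.Eventually.of_forall hB)), gaussianReal_conv_gaussianReal, hmap _ f hf,
    Real.sq_sqrt (by positivity), Real.toNNReal_add (sq_nonneg b) (sq_nonneg c), add_zero]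

lemma integral_pi_succ_comp_sum {f : ℝ → ℝ} (hf : Continuous f) {B : ℝ} (hB : ∀ x, |f x| ≤ B)
    (μ : Measure ℝ) [IsProbabilityMeasure μ] (n : ℕ) (a c : ℝ) :
    ∫ ω, f (a + c * ∑ i, ω i) ∂(Measure.pi fun _ : Fin (n + 1) => μ) =
      ∫ ω, ∫ x, f (a + c * ∑ i, ω i + c * x) ∂μ ∂(Measure.pi fun _ : Fin n => μ) := by
  have hmp := measurePreserving_piFinSuccAbove (fun _ : Fin (n + 1) => μ) 0
  have h := hmp.integral_comp (MeasurableEquiv.measurableEmbedding _)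
    (fun p : ℝ × (Fin n → ℝ) => f (a + c * ∑ i, p.2 i + c * p.1))
  have hint : Integrable (fun p : ℝ × (Fin n → ℝ) => f (a + c * ∑ i, p.2 i + c * p.1))
      (μ.prod (Measure.pi fun _ : Fin n => μ)) :=
    Integrable.of_bound (Continuous.aestronglyMeasurable (by fun_prop)) B
      (Filter.Eventually.of_forall fun p => hB _)
  rw [integral_prod_symm _ hint] at h
  rw [← h]
  refine integral_congr_ae (Filter.Eventually.of_forall fun ω => ?_)
  have hs : a + c * ∑ i, ω i = a + c * ∑ i : Fin n, ω i.succ + c * ω 0 := by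
    rw [Fin.sum_univ_succ]; ring
  simp only [hs]
  rfl

/-- Lindeberg replacement for a smooth bounded test function. -/
lemma abs_integral_pi_sub_integral_gaussianReal_le {f f₁ f₂ f₃ : ℝ → ℝ} {B K : ℝ}
    (hf : ∀ x, HasDerivAt f (f₁ x) x) (hf₁ : ∀ x, HasDerivAt f₁ (f₂ x) x)
    (hf₂ : ∀ x, HasDerivAt f₂ (f₃ x) x) (hB : ∀ x, |f x| ≤ B) (hK : ∀ x, |f₃ x| ≤ K)
    {μ : Measure ℝ} [IsProbabilityMeasure μ] (hi₁ : Integrable (fun x => x) μ)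
    (hm₁ : ∫ x, x ∂μ = 0) (hm₂ : ∫ x, x ^ 2 ∂μ = 1) (hi₃ : Integrable (fun x => |x| ^ 3) μ)
    {c : ℝ} (hc : 0 ≤ c) (n : ℕ) (a : ℝ) :
    |∫ ω, f (a + c * ∑ i, ω i) ∂(Measure.pi fun _ : Fin n => μ) -
        ∫ z, f (a + c * √n * z) ∂(gaussianReal 0 1)| ≤
      n * (K * c ^ 3 * (∫ x, |x| ^ 3 ∂μ + ∫ z, |z| ^ 3 ∂(gaussianReal 0 1))) := by
  have hcont : Continuous f := continuous_iff_continuousAt.2 fun x => (hf x).continuousAt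
  have hg₁ : Integrable (fun x : ℝ => x) (gaussianReal 0 1) :=
    (memLp_id_gaussianReal 1).integrable le_rfl
  have hgm₁ : ∫ x, x ∂(gaussianReal 0 1) = 0 := integral_id_gaussianReal
  have hgm₂ : ∫ x, x ^ 2 ∂(gaussianReal 0 1) = 1 := by
    have h := variance_id_gaussianReal (μ := 0) (v := 1)
    rw [variance_of_integral_eq_zero aemeasurable_id (by simp)] at h
    simpa using h
  have hg₃ : Integrable (fun x : ℝ => |x| ^ 3) (gaussianReal 0 1) := by
    have h := (memLp_id_gaussianReal (μ := 0) (v := 1) 3).integrable_norm_pow (p := 3) (by simp)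
    simpa using h
  have hcontμ : ∀ ν : Measure ℝ, IsProbabilityMeasure ν → ∀ d : ℝ,
      Continuous fun s => ∫ x, f (s + d * x) ∂ν := fun ν _ d =>
    continuous_of_dominated (bound := fun _ => B) (fun z => by fun_prop)
      (fun z => Filter.Eventually.of_forall fun w => hB _) (integrable_const _)
      (Filter.Eventually.of_forall fun w => by fun_prop)
  have hBμ : ∀ ν : Measure ℝ, IsProbabilityMeasure ν → ∀ d s : ℝ,
      |∫ x, f (s + d * x) ∂ν| ≤ B := fun ν _ d s =>
    abs_integral_le_of_forall_abs_le fun x => hB (s + d * x)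
  induction n generalizing a with
  | zero => simp
  | succ n ih =>
    set D := K * c ^ 3 * (∫ x, |x| ^ 3 ∂μ + ∫ z, |z| ^ 3 ∂(gaussianReal 0 1)) with hD
    have hintμ : ∀ ν : Measure ℝ, IsProbabilityMeasure ν →
        Integrable (fun ω : Fin n → ℝ => ∫ x, f (a + c * ∑ i, ω i + c * x) ∂ν)
          (Measure.pi fun _ : Fin n => μ) := fun ν hν =>
      Integrable.of_bound (((hcontμ ν hν c).comp (g := fun s => ∫ x, f (s + c * x) ∂ν)
        (f := fun ω : Fin n → ℝ => a + c * ∑ i, ω i) (by fun_prop)).aestronglyMeasurable) B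
        (Filter.Eventually.of_forall fun ω => hBμ ν hν c _)
    have hone : ∀ s, |∫ x, f (s + c * x) ∂μ - ∫ x, f (s + c * x) ∂(gaussianReal 0 1)| ≤ D := by
      intro s
      have h₁ := abs_le.1 (abs_integral_comp_sub_taylor_two_le hf hf₁ hf₂ hB hK hi₁ hm₁ hm₂ hi₃
        hc s)
      have h₂ := abs_le.1 (abs_integral_comp_sub_taylor_two_le hf hf₁ hf₂ hB hK hg₁ hgm₁ hgm₂ hg₃
        hc s)
      rw [hD, mul_add, abs_le]
      constructor <;> linarith [h₁.1, h₁.2, h₂.1, h₂.2]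
    have hstep : |∫ ω, f (a + c * ∑ i, ω i) ∂(Measure.pi fun _ : Fin (n + 1) => μ) -
        ∫ ω, ∫ z, f (a + c * ∑ i, ω i + c * z) ∂(gaussianReal 0 1)
          ∂(Measure.pi fun _ : Fin n => μ)| ≤ D := by
      rw [integral_pi_succ_comp_sum hcont hB, ← integral_sub (hintμ μ inferInstance)
        (hintμ (gaussianReal 0 1) inferInstance)]
      exact abs_integral_le_of_forall_abs_le fun ω : Fin n → ℝ => hone (a + c * ∑ i, ω i)
    have hswap : ∫ ω, ∫ z, f (a + c * ∑ i, ω i + c * z) ∂(gaussianReal 0 1)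
          ∂(Measure.pi fun _ : Fin n => μ) =
        ∫ z, ∫ ω, f (a + c * z + c * ∑ i, ω i) ∂(Measure.pi fun _ : Fin n => μ)
          ∂(gaussianReal 0 1) := by
      rw [integral_integral_swap]
      · simp_rw [add_right_comm]
      · exact Integrable.of_bound (Continuous.aestronglyMeasurable (by fun_prop)) B
          (Filter.Eventually.of_forall fun p => hB _)
    have hgauss : ∫ z, ∫ w, f (a + c * z + c * √n * w) ∂(gaussianReal 0 1) ∂(gaussianReal 0 1) =
        ∫ z, f (a + c * √(n + 1 : ℕ) * z) ∂(gaussianReal 0 1) := by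
      have h := integral_gaussianReal_gaussianReal_add (f := fun x => f (a + x)) (by fun_prop)
        (fun x => hB _) c (c * √n)
      have hs : √(c ^ 2 + (c * √n) ^ 2) = c * √(n + 1 : ℕ) := by
        rw [mul_pow, Real.sq_sqrt (Nat.cast_nonneg n), ← mul_one_add, Real.sqrt_mul (sq_nonneg c),
          Real.sqrt_sq hc, Nat.cast_succ, add_comm]
      rw [hs] at h
      simpa only [add_assoc] using h
    have hintpi : Integrable (fun z => ∫ ω, f (a + c * z + c * ∑ i, ω i)
        ∂(Measure.pi fun _ : Fin n => μ)) (gaussianReal 0 1) := by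
      refine Integrable.of_bound (Continuous.aestronglyMeasurable ?_) B
        (Filter.Eventually.of_forall fun z => ?_)
      · exact continuous_of_dominated (bound := fun _ => B)
          (fun z => Continuous.aestronglyMeasurable (by fun_prop))
          (fun z => Filter.Eventually.of_forall fun w => hB _) (integrable_const _)
          (Filter.Eventually.of_forall fun w => by fun_prop)
      · exact abs_integral_le_of_forall_abs_le fun ω : Fin n → ℝ => hB (a + c * z + c * ∑ i, ω i)
    have hintg : Integrable (fun z => ∫ w, f (a + c * z + c * √n * w) ∂(gaussianReal 0 1))
        (gaussianReal 0 1) :=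
      Integrable.of_bound (((hcontμ (gaussianReal 0 1) inferInstance (c * √n)).comp
        (g := fun s => ∫ x, f (s + c * √n * x) ∂(gaussianReal 0 1))
        (f := fun z => a + c * z) (by fun_prop)).aestronglyMeasurable) B
        (Filter.Eventually.of_forall fun z => hBμ _ inferInstance _ _)
    have hrest : |∫ z, ∫ ω, f (a + c * z + c * ∑ i, ω i) ∂(Measure.pi fun _ : Fin n => μ)
          ∂(gaussianReal 0 1) - ∫ z, f (a + c * √(n + 1 : ℕ) * z) ∂(gaussianReal 0 1)| ≤
        n * D := by
      rw [← hgauss, ← integral_sub hintpi hintg]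
      exact abs_integral_le_of_forall_abs_le fun z => ih (a + c * z)
    rw [← hswap] at hrest
    push_cast at hrest ⊢
    calc _ ≤ D + n * D := (abs_sub_le _ _ _).trans (add_le_add hstep hrest)
      _ = (n + 1) * D := by ring

/-- **Lindeberg swapping bound for Gaussian-smoothed test functions.**
For a polynomial `P` there is a constant `C` depending only on `P` such that: if
`X₁, …, Xₙ` are i.i.d. with law `μ`, mean `0`, variance `1` and `E|X₁|³ < ∞`, `h` is
measurable with `|h| ≤ M`, `σ > 0`, and `h₁(x) = E[h(σZ + x) P(Z)]` (with `Z ~ N(0,1)`),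
then for every `σ₁ ≥ 0`,
`|E[h₁((σ₁/√n) ∑ Xᵢ)] - E[h₁(σ₁ Z)]| ≤ C M σ₁³ / (σ³ √n) · (E|X₁|³ + E|Z|³)`. -/
theorem lindeberg_swap_smooth_bound (P : Polynomial ℝ) :
    ∃ C : ℝ, ∀ (μ : Measure ℝ), IsProbabilityMeasure μ →
      Integrable (fun x => x) μ → (∫ x, x ∂μ) = 0 → (∫ x, x ^ 2 ∂μ) = 1 →
      Integrable (fun x => |x| ^ 3) μ →
      ∀ n : ℕ, 1 ≤ n →
      ∀ h : ℝ → ℝ, Measurable h → ∀ M : ℝ, (∀ x, |h x| ≤ M) →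
      ∀ σ : ℝ, 0 < σ → ∀ σ₁ : ℝ, 0 ≤ σ₁ →
      |(∫ ω, (∫ y, P.eval y * h (σ * y + σ₁ / Real.sqrt n * ∑ i, ω i) ∂(gaussianReal 0 1))
            ∂(Measure.pi fun _ : Fin n => μ)) -
          ∫ z, (∫ y, P.eval y * h (σ * y + σ₁ * z) ∂(gaussianReal 0 1)) ∂(gaussianReal 0 1)|
        ≤ C * M * σ₁ ^ 3 / (σ ^ 3 * Real.sqrt n) *
            ((∫ x, |x| ^ 3 ∂μ) + ∫ z, |z| ^ 3 ∂(gaussianReal 0 1)) := by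
  refine ⟨∫ x, |(gaussianAdjointDeriv (gaussianAdjointDeriv (gaussianAdjointDeriv P))).eval x *
    gaussianPDFReal 0 1 x|, ?_⟩
  intro μ _ hi₁ hm₁ hm₂ hi₃ n hn h hh M hM σ hσ σ₁ hσ₁
  have hk : Measurable fun u => h (σ * u) := hh.comp (measurable_const_mul σ)
  have hkM : ∀ u, |h (σ * u)| ≤ M := fun u => hM _
  have hs : 0 < √(n : ℝ) := Real.sqrt_pos.2 (by exact_mod_cast hn)
  have key := abs_integral_pi_sub_integral_gaussianReal_le
    (hasDerivAt_gaussianSmoothing hk hkM P) (hasDerivAt_gaussianSmoothing hk hkM _)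
    (hasDerivAt_gaussianSmoothing hk hkM _) (abs_gaussianSmoothing_le hkM P)
    (abs_gaussianSmoothing_le hkM _) hi₁ hm₁ hm₂ hi₃ (c := σ⁻¹ * (σ₁ / √n)) (by positivity) n 0
  simp_rw [integral_eval_mul_gaussianReal_eq_gaussianSmoothing P h hσ.ne']
  have hc : σ⁻¹ * (σ₁ / √n) * √n = σ⁻¹ * σ₁ := by field_simp
  simp only [zero_add, hc, mul_assoc] at key ⊢
  refine key.trans (le_of_eq ?_)
  have hn' : (n : ℝ) = √n * √n := (Real.mul_self_sqrt (Nat.cast_nonneg n)).symm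
  generalize √(n : ℝ) = r at hs hn' ⊢
  rw [hn']
  field_simp
end

section
/- There exists a universal constant C such that the following holds. Let l ≥ 1, let S ~ Bin(l, 1/2) be a binomial random variable, and let Z ~ N(0,1). Let h : ℝ → ℝ be measurable with |h(x)| ≤ 1 for all x and such that for every integer z, h is constant on the interval (z − 1/2, z + 1/2). Then |E[h(S)] − E[h(l/2 + Z·√(l/4))]| ≤ C/l. -/
open MeasureTheory ProbabilityTheory

theorem stirlingSeq_mul_one_sub_inv_le_succ {n : ℕ} (hn : n ≠ 0) :
    Stirling.stirlingSeq n * (1 - 1 / n) ≤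
      Stirling.stirlingSeq (n + 1) * (1 - 1 / ((n + 1 : ℕ) : ℝ)) := by
  have hpos : 0 < Stirling.stirlingSeq n := by
    obtain ⟨m, rfl⟩ := Nat.exists_eq_succ_of_ne_zero hn
    exact Stirling.stirlingSeq'_pos m
  have hpos' : 0 < Stirling.stirlingSeq (n + 1) := Stirling.stirlingSeq'_pos n
  have hn0 : (0 : ℝ) < n := by positivity
  have hlog := Stirling.log_stirlingSeq_sdiff_le n
  have hsq : (1 : ℝ) / (12 * n * (n + 1)) ≤ 1 / n ^ 2 := by
    apply one_div_le_one_div_of_le (by positivity); nlinarith [sq_nonneg (n : ℝ)]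
  have hstep : Stirling.stirlingSeq n * (1 - 1 / n ^ 2) ≤ Stirling.stirlingSeq (n + 1) := by
    calc Stirling.stirlingSeq n * (1 - 1 / n ^ 2)
        ≤ Stirling.stirlingSeq n * Real.exp (-(1 / n ^ 2)) := by
          gcongr; linarith [Real.add_one_le_exp (-(1 / (n : ℝ) ^ 2))]
      _ = Real.exp (Real.log (Stirling.stirlingSeq n) - 1 / n ^ 2) := by
          rw [sub_eq_add_neg, Real.exp_add, Real.exp_log hpos]
      _ ≤ Real.exp (Real.log (Stirling.stirlingSeq (n + 1))) := by gcongr; linarith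
      _ = _ := Real.exp_log hpos'
  calc Stirling.stirlingSeq n * (1 - 1 / n)
      = Stirling.stirlingSeq n * (1 - 1 / n ^ 2) * (n / (n + 1)) := by field_simp; ring
    _ ≤ Stirling.stirlingSeq (n + 1) * (n / (n + 1)) := by gcongr
    _ = _ := by push_cast; field_simp; ring

theorem stirlingSeq_mul_one_sub_inv_le_sqrt_pi {n : ℕ} (hn : n ≠ 0) :
    Stirling.stirlingSeq n * (1 - 1 / n) ≤ √Real.pi := by
  obtain ⟨m, rfl⟩ := Nat.exists_eq_succ_of_ne_zero hn
  have hmono : Monotone fun m : ℕ =>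
      Stirling.stirlingSeq (m + 1) * (1 - 1 / ((m + 1 : ℕ) : ℝ)) :=
    monotone_nat_of_le_succ fun m => stirlingSeq_mul_one_sub_inv_le_succ m.succ_ne_zero
  refine hmono.ge_of_tendsto ?_ m
  have h1 : Filter.Tendsto (fun m : ℕ => (1 : ℝ) - 1 / ((m + 1 : ℕ) : ℝ)) Filter.atTop
      (nhds (1 - 0)) := by
    simpa using (tendsto_one_div_add_atTop_nhds_zero_nat (𝕜 := ℝ)).const_sub 1
  simpa using (Stirling.tendsto_stirlingSeq_sqrt_pi.comp (Filter.tendsto_add_atTop_nat 1)).mul h1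

/-- Pinsker's inequality for a two-point distribution compared with the fair coin. -/
theorem sq_le_one_add_mul_log_add_one_sub_mul_log {u : ℝ} (h₁ : -1 < u) (h₂ : u < 1) :
    u ^ 2 ≤ (1 + u) * Real.log (1 + u) + (1 - u) * Real.log (1 - u) := by
  have gibbs {a b : ℝ} (ha : 0 < a) (hb : 0 < b) : a * Real.log b + a - b ≤ a * Real.log a := by
    have h := Real.log_le_sub_one_of_pos (div_pos hb ha)
    rw [Real.log_div hb.ne' ha.ne'] at h
    have h' := mul_le_mul_of_nonneg_left h ha.le
    have : a * (b / a - 1) = b - a := by field_simp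
    linarith
  have hc := Real.cosh_pos u
  have hlog : Real.log (Real.cosh u) ≤ u ^ 2 / 2 :=
    (Real.log_le_iff_le_exp hc).2 (Real.cosh_le_exp_half_sq u)
  have hsum : Real.exp u / Real.cosh u + Real.exp (-u) / Real.cosh u = 2 := by
    rw [← add_div, div_eq_iff hc.ne', Real.cosh_eq]; ring
  have g₁ := gibbs (by linarith : 0 < 1 + u) (div_pos (Real.exp_pos u) hc)
  have g₂ := gibbs (by linarith : 0 < 1 - u) (div_pos (Real.exp_pos (-u)) hc)
  rw [Real.log_div (Real.exp_pos _).ne' hc.ne', Real.log_exp] at g₁ g₂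
  linarith

theorem natCast_add_div_pow_le {k j : ℕ} (hk : k ≠ 0) (hj : j ≠ 0) :
    (((k + j : ℕ) : ℝ) / Real.exp 1) ^ (k + j) ≤
      2 ^ (k + j) * Real.exp (-((k : ℝ) - j) ^ 2 / (2 * (k + j))) *
        (((k : ℝ) / Real.exp 1) ^ k * ((j : ℝ) / Real.exp 1) ^ j) := by
  have hk0 : (0 : ℝ) < k := by positivity
  have hj0 : (0 : ℝ) < j := by positivity
  have hl0 : (0 : ℝ) < k + j := by positivity
  have hpow {x : ℝ} (hx : 0 < x) (n : ℕ) : x ^ n = Real.exp (n * Real.log x) := by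
    rw [Real.exp_nat_mul, Real.exp_log hx]
  push_cast
  rw [hpow (by positivity : 0 < ((k : ℝ) + j) / Real.exp 1), hpow two_pos,
    hpow (by positivity : 0 < (k : ℝ) / Real.exp 1),
    hpow (by positivity : 0 < (j : ℝ) / Real.exp 1), ← Real.exp_add, ← Real.exp_add,
    ← Real.exp_add, Real.exp_le_exp, Real.log_div hl0.ne' (Real.exp_pos 1).ne',
    Real.log_div hk0.ne' (Real.exp_pos 1).ne', Real.log_div hj0.ne' (Real.exp_pos 1).ne',
    Real.log_exp]
  have h := sq_le_one_add_mul_log_add_one_sub_mul_log (u := ((k : ℝ) - j) / (k + j))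
    (by rw [lt_div_iff₀ hl0]; linarith) (by rw [div_lt_iff₀ hl0]; linarith)
  have e₁ : 1 + ((k : ℝ) - j) / (k + j) = 2 * k / (k + j) := by field_simp; ring
  have e₂ : 1 - ((k : ℝ) - j) / (k + j) = 2 * j / (k + j) := by field_simp; ring
  rw [e₁, e₂, Real.log_div (by positivity) hl0.ne', Real.log_div (by positivity) hl0.ne',
    Real.log_mul two_ne_zero hk0.ne', Real.log_mul two_ne_zero hj0.ne'] at h
  have h' := mul_le_mul_of_nonneg_left h (by positivity : (0 : ℝ) ≤ (k + j) / 2)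
  have l₁ : ((k : ℝ) + j) / 2 * (((k : ℝ) - j) / (k + j)) ^ 2
      = -(-((k : ℝ) - j) ^ 2 / (2 * (k + j))) := by field_simp
  have l₂ (x y : ℝ) : ((k : ℝ) + j) / 2 * (2 * k / (k + j) * x + 2 * j / (k + j) * y)
      = k * x + j * y := by field_simp
  rw [l₁, l₂] at h'
  push_cast
  linarith

theorem sqrt_natCast_add_mul_le {k j : ℕ} (hk : k ≠ 0) (hj : j ≠ 0) :
    √Real.pi * √(2 * (k + j)) * (4 * k * j / (k + j) ^ 2) ≤
      (√(2 * Real.pi * ((k + j) / 4)))⁻¹ * (√(2 * Real.pi * k) * √(2 * Real.pi * j)) := by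
  have hk0 : (0 : ℝ) < k := by positivity
  have hj0 : (0 : ℝ) < j := by positivity
  have hπ := Real.pi_pos
  rw [le_inv_mul_iff₀ (by positivity), ← Real.sqrt_mul (by positivity),
    ← Real.sqrt_mul (by positivity), ← mul_assoc, ← Real.sqrt_mul (by positivity)]
  have e : 2 * Real.pi * (((k : ℝ) + j) / 4) * (Real.pi * (2 * (k + j)))
      = (Real.pi * (k + j)) ^ 2 := by ring
  rw [e, Real.sqrt_sq (by positivity)]
  apply Real.le_sqrt_of_sq_le
  have h : 4 * (k : ℝ) * j / (k + j) ^ 2 ≤ 1 := by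
    rw [div_le_one (by positivity)]; nlinarith [sq_nonneg ((k : ℝ) - j)]
  calc (Real.pi * ((k : ℝ) + j) * (4 * k * j / (k + j) ^ 2)) ^ 2
      = 2 * Real.pi * k * (2 * Real.pi * j) * (4 * (k : ℝ) * j / (k + j) ^ 2) := by
        field_simp; ring
    _ ≤ 2 * Real.pi * k * (2 * Real.pi * j) * 1 := by gcongr
    _ = _ := mul_one _

theorem choose_div_two_pow_mul_le {k j : ℕ} (hk : k ≠ 0) (hj : j ≠ 0) :
    ((k + j).choose k : ℝ) / 2 ^ (k + j) * (1 - 1 / (k + j)) * (4 * k * j / (k + j) ^ 2) ≤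
      (√(2 * Real.pi * ((k + j) / 4)))⁻¹ * Real.exp (-((k : ℝ) - j) ^ 2 / (2 * (k + j))) := by
  have hk0 : (0 : ℝ) < k := by positivity
  have hj0 : (0 : ℝ) < j := by positivity
  have hfac : ((k + j).factorial : ℝ) * (1 - 1 / (k + j)) ≤
      √Real.pi * √(2 * (k + j)) * (((k + j : ℕ) : ℝ) / Real.exp 1) ^ (k + j) := by
    have h := stirlingSeq_mul_one_sub_inv_le_sqrt_pi (n := k + j) (by omega)
    rw [Stirling.stirlingSeq, div_mul_eq_mul_div, div_le_iff₀ (by positivity)] at h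
    push_cast at h ⊢
    linarith
  have hch : ((k + j).choose k : ℝ) * (k.factorial * j.factorial) = (k + j).factorial := by
    have := Nat.add_choose_mul_factorial_mul_factorial k j
    rw [← Nat.choose_symm_add] at this
    rw [← mul_assoc]; exact_mod_cast this
  have hK : (0 : ℝ) < k.factorial * j.factorial := by positivity
  refine le_of_mul_le_mul_right ?_ (mul_pos hK (pow_pos (two_pos (α := ℝ)) (k + j)))
  calc ((k + j).choose k : ℝ) / 2 ^ (k + j) * (1 - 1 / (k + j)) * (4 * k * j / (k + j) ^ 2)
        * (k.factorial * j.factorial * 2 ^ (k + j))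
      = ((k + j).factorial : ℝ) * (1 - 1 / (k + j)) * (4 * k * j / (k + j) ^ 2) := by
        rw [← hch]; field_simp
    _ ≤ √Real.pi * √(2 * (k + j)) * (((k + j : ℕ) : ℝ) / Real.exp 1) ^ (k + j)
          * (4 * k * j / (k + j) ^ 2) := by gcongr
    _ = √Real.pi * √(2 * (k + j)) * (4 * k * j / (k + j) ^ 2)
          * (((k + j : ℕ) : ℝ) / Real.exp 1) ^ (k + j) := by ring
    _ ≤ (√(2 * Real.pi * ((k + j) / 4)))⁻¹ * (√(2 * Real.pi * k) * √(2 * Real.pi * j))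
          * (2 ^ (k + j) * Real.exp (-((k : ℝ) - j) ^ 2 / (2 * (k + j))) *
        (((k : ℝ) / Real.exp 1) ^ k * ((j : ℝ) / Real.exp 1) ^ j)) :=
        mul_le_mul (sqrt_natCast_add_mul_le hk hj) (natCast_add_div_pow_le hk hj)
          (by positivity) (by positivity)
    _ = (√(2 * Real.pi * ((k + j) / 4)))⁻¹ * Real.exp (-((k : ℝ) - j) ^ 2 / (2 * (k + j)))
          * ((√(2 * Real.pi * k) * ((k : ℝ) / Real.exp 1) ^ k)
            * (√(2 * Real.pi * j) * ((j : ℝ) / Real.exp 1) ^ j) * 2 ^ (k + j)) := by ring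
    _ ≤ _ := by
        gcongr
        · exact Stirling.le_factorial_stirling k
        · exact Stirling.le_factorial_stirling j

open scoped NNReal in
theorem gaussianPDFReal_mul_le_measureReal_Ioc (μ : ℝ) {v : ℝ≥0} (hv : v ≠ 0) (c : ℝ) :
    gaussianPDFReal μ v c * (1 - 1 / (24 * v)) ≤
      (gaussianReal μ v).real (Set.Ioc (c - 1 / 2) (c + 1 / 2)) := by
  have hv0 : (0 : ℝ) < v := by positivity
  have hle : c - 1 / 2 ≤ c + 1 / 2 := by linarith
  rw [measureReal_def, gaussianReal_apply_eq_integral μ hv, ENNReal.toReal_ofReal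
    (integral_nonneg fun x => gaussianPDFReal_nonneg μ v x),
    ← intervalIntegral.integral_of_le hle]
  have hpoly : ∫ x in (c - 1 / 2)..(c + 1 / 2),
      gaussianPDFReal μ v c * (1 - ((x - c) ^ 2 + 2 * (c - μ) * (x - c)) / (2 * v)) =
      gaussianPDFReal μ v c * (1 - 1 / (24 * v)) := by
    rw [intervalIntegral.integral_comp_sub_right
      (fun y => gaussianPDFReal μ v c * (1 - (y ^ 2 + 2 * (c - μ) * y) / (2 * v))) c,
      intervalIntegral.integral_const_mul, intervalIntegral.integral_sub
        (Continuous.intervalIntegrable (by fun_prop) _ _)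
        (Continuous.intervalIntegrable (by fun_prop) _ _),
      intervalIntegral.integral_div, intervalIntegral.integral_add
        (Continuous.intervalIntegrable (by fun_prop) _ _)
        (Continuous.intervalIntegrable (by fun_prop) _ _),
      intervalIntegral.integral_const_mul, integral_pow, integral_id,
      intervalIntegral.integral_const]
    simp only [smul_eq_mul]
    field_simp
    ring
  rw [← hpoly]
  refine intervalIntegral.integral_mono_on hle (Continuous.intervalIntegrable (by fun_prop) _ _)
    (integrable_gaussianPDFReal μ v).intervalIntegrable fun x _ => ?_
  have hx : -(x - μ) ^ 2 / (2 * v) = -(c - μ) ^ 2 / (2 * v) +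
      -(((x - c) ^ 2 + 2 * (c - μ) * (x - c)) / (2 * v)) := by field_simp; ring
  rw [gaussianPDFReal, gaussianPDFReal, hx, Real.exp_add, ← mul_assoc]
  gcongr
  linarith [Real.add_one_le_exp (-(((x - c) ^ 2 + 2 * (c - μ) * (x - c)) / (2 * v)))]

theorem choose_div_two_pow_mul_le_measureReal_Ioc {l k : ℕ} (hl : l ≠ 0) (hk : k ≤ l) :
    (l.choose k : ℝ) / 2 ^ l * (1 - (2 / l + (2 * k / l - 1) ^ 2)) ≤
      (gaussianReal (l / 2) (l / 4)).real (Set.Ioc ((k : ℝ) - 1 / 2) (k + 1 / 2)) := by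
  have hl0 : (0 : ℝ) < l := by positivity
  have hp : 0 ≤ (l.choose k : ℝ) / 2 ^ l := by positivity
  have of_edge (h : (2 * (k : ℝ) / l - 1) ^ 2 = 1) : (l.choose k : ℝ) / 2 ^ l *
      (1 - (2 / l + (2 * k / l - 1) ^ 2)) ≤
      (gaussianReal (l / 2) (l / 4)).real (Set.Ioc ((k : ℝ) - 1 / 2) (k + 1 / 2)) := by
    refine le_trans (mul_nonpos_of_nonneg_of_nonpos hp ?_) measureReal_nonneg
    have : 0 ≤ 2 / (l : ℝ) := by positivity
    linarith
  rcases eq_or_ne k 0 with rfl | hk0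
  · exact of_edge (by simp)
  obtain ⟨j, rfl⟩ := Nat.exists_eq_add_of_le hk
  rcases eq_or_ne j 0 with rfl | hj0
  · exact of_edge (by simp at hl0 ⊢; field_simp; norm_num)
  have hkpos : (0 : ℝ) < k := by positivity
  have hjpos : (0 : ℝ) < j := by positivity
  have hl1 : (1 : ℝ) ≤ k + j := by exact_mod_cast Nat.one_le_iff_ne_zero.2 hl
  have hcell := gaussianPDFReal_mul_le_measureReal_Ioc (((k + j : ℕ) : ℝ) / 2)
    (v := ((k + j : ℕ) : NNReal) / 4) (by positivity) k
  refine le_trans ?_ hcell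
  have hloc := choose_div_two_pow_mul_le hk0 hj0
  have hpdf : gaussianPDFReal (((k + j : ℕ) : ℝ) / 2) (((k + j : ℕ) : NNReal) / 4) k =
      (√(2 * Real.pi * ((k + j) / 4)))⁻¹ * Real.exp (-((k : ℝ) - j) ^ 2 / (2 * (k + j))) := by
    rw [gaussianPDFReal]
    push_cast
    congr 2
    field_simp
    ring
  rw [← hpdf] at hloc
  push_cast at hp hloc ⊢
  have ha : 1 / ((k : ℝ) + j) ≤ 1 := (div_le_one (by positivity)).2 hl1
  have ha0 : 0 < 1 / ((k : ℝ) + j) := by positivity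
  have hw : 4 * (k : ℝ) * j / (k + j) ^ 2 = 1 - (2 * k / (k + j) - 1) ^ 2 := by
    field_simp; ring
  have hw0 : 0 < 4 * (k : ℝ) * j / (k + j) ^ 2 := by positivity
  have hb : 1 / (24 * (((k : ℝ) + j) / 4)) = 1 / (k + j) / 6 := by field_simp; norm_num
  rw [hb]
  refine le_trans ?_ (mul_le_mul_of_nonneg_right hloc (by linarith))
  rw [mul_assoc, mul_assoc]
  refine mul_le_mul_of_nonneg_left ?_ hp
  rw [hw] at hw0 ⊢
  have h2 : 2 / ((k : ℝ) + j) = 2 * (1 / (k + j)) := by ring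
  rw [h2]
  generalize 1 / ((k : ℝ) + j) = a at *
  set t := (2 * (k : ℝ) / (k + j) - 1) ^ 2 with ht
  have ht0 : 0 ≤ t := sq_nonneg _
  have := mul_nonneg ht0 (by linarith : 0 ≤ 1 - a)
  have := mul_nonneg (mul_nonneg ht0 ha0.le) (by linarith : 0 ≤ 1 - a)
  nlinarith [mul_nonneg ht0 ha0.le, mul_nonneg ha0.le ha0.le]

theorem sum_choose_div_two_pow (l : ℕ) :
    ∑ k ∈ Finset.range (l + 1), (l.choose k : ℝ) / 2 ^ l = 1 := by
  rw [← Finset.sum_div, div_eq_one_iff_eq (by positivity)]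
  exact_mod_cast Nat.sum_range_choose l

theorem sum_choose_div_two_pow_mul_sq {l : ℕ} (hl : l ≠ 0) :
    ∑ k ∈ Finset.range (l + 1), (l.choose k : ℝ) / 2 ^ l * (2 * k / l - 1) ^ 2 = 1 / (l : ℝ) := by
  have hl0 : (0 : ℝ) < l := by positivity
  have h := congrArg (Polynomial.eval (1 / 2 : ℝ)) (bernsteinPolynomial.variance ℝ l)
  simp only [Polynomial.eval_finsetSum, nsmul_eq_mul, bernsteinPolynomial, Polynomial.eval_mul,
    Polynomial.eval_pow, Polynomial.eval_sub, Polynomial.eval_natCast, Polynomial.eval_X,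
    Polynomial.eval_one] at h
  have h' : (1 : ℝ) / l = (4 / l ^ 2) * (l * (1 / 2) * (1 - 1 / 2)) := by field_simp; norm_num
  rw [h', ← h, Finset.mul_sum]
  refine Finset.sum_congr rfl fun k hk => ?_
  have hk : k + (l - k) = l := by have := Finset.mem_range.1 hk; omega
  have e : (1 / 2 : ℝ) ^ k * (1 - 1 / 2) ^ (l - k) = 1 / 2 ^ l := by
    rw [show (1 - 1 / 2 : ℝ) = 1 / 2 by norm_num, ← pow_add, hk, one_div_pow]
  rw [mul_assoc _ ((1 / 2 : ℝ) ^ k), e]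
  field_simp
  ring

theorem setIntegral_Ioc_eq_sum_cells {ν : Measure ℝ} [IsProbabilityMeasure ν]
    [NullSingletonClass ν] {h : ℝ → ℝ} (hint : Integrable h ν)
    (hcell : ∀ z : ℤ, ∀ x ∈ Set.Ioo ((z : ℝ) - 1 / 2) ((z : ℝ) + 1 / 2), h x = h z) (n : ℕ) :
    ∫ x in Set.Ioc (-1 / 2 : ℝ) (n - 1 / 2), h x ∂ν =
      ∑ k ∈ Finset.range n, ν.real (Set.Ioc ((k : ℝ) - 1 / 2) (k + 1 / 2)) * h k := by
  have hsum := intervalIntegral.sum_integral_adjacent_intervals (μ := ν) (f := h) (n := n)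
    (a := fun k : ℕ => (k : ℝ) - 1 / 2) fun k _ => hint.intervalIntegrable
  have hle : (-1 / 2 : ℝ) ≤ n - 1 / 2 := by have := n.cast_nonneg (α := ℝ); linarith
  rw [← intervalIntegral.integral_of_le hle]
  have h0 : ((0 : ℕ) : ℝ) - 1 / 2 = -1 / 2 := by norm_num
  rw [h0] at hsum
  rw [← hsum]
  refine Finset.sum_congr rfl fun k _ => ?_
  have hk : ((k + 1 : ℕ) : ℝ) - 1 / 2 = k + 1 / 2 := by push_cast; ring
  rw [hk, intervalIntegral.integral_of_le (by linarith), integral_Ioc_eq_integral_Ioo,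
    setIntegral_congr_fun (g := fun _ => h k) measurableSet_Ioo
      fun x hx => by simpa using hcell k x (by simpa using hx),
    setIntegral_const, smul_eq_mul, measureReal_congr Ioo_ae_eq_Ioc]

/-- A one-sided comparison of the weights `p k` with the masses of the unit cells around `k`
suffices to compare expectations of lattice-constant functions, because both sides have total
mass one. -/
theorem abs_sum_mul_sub_integral_le {ν : Measure ℝ} [IsProbabilityMeasure ν]
    [NullSingletonClass ν] {h : ℝ → ℝ} (hm : Measurable h) (hb : ∀ x, |h x| ≤ 1)
    (hcell : ∀ z : ℤ, ∀ x ∈ Set.Ioo ((z : ℝ) - 1 / 2) ((z : ℝ) + 1 / 2), h x = h z)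
    {n : ℕ} {p e : ℕ → ℝ} (hp : ∑ k ∈ Finset.range n, p k = 1)
    (he : ∀ k ∈ Finset.range n, 0 ≤ p k * e k)
    (hpe : ∀ k ∈ Finset.range n,
      p k * (1 - e k) ≤ ν.real (Set.Ioc ((k : ℝ) - 1 / 2) (k + 1 / 2))) :
    |∑ k ∈ Finset.range n, p k * h k - ∫ x, h x ∂ν| ≤
      2 * ∑ k ∈ Finset.range n, p k * e k := by
  set q : ℕ → ℝ := fun k => ν.real (Set.Ioc ((k : ℝ) - 1 / 2) (k + 1 / 2)) with hq
  set A : Set ℝ := Set.Ioc (-1 / 2 : ℝ) (n - 1 / 2) with hA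
  have hAm : MeasurableSet A := measurableSet_Ioc
  have hint : Integrable h ν := Integrable.of_bound hm.aestronglyMeasurable 1 (ae_of_all _ hb)
  have hin : ∫ x in A, h x ∂ν = ∑ k ∈ Finset.range n, q k * h k :=
    setIntegral_Ioc_eq_sum_cells hint hcell n
  have hmass : ν.real A = ∑ k ∈ Finset.range n, q k := by
    have := setIntegral_Ioc_eq_sum_cells (ν := ν) (h := fun _ => 1) (integrable_const _)
      (fun _ _ _ => rfl) n
    simpa [hA, hq] using this
  have htail : |∫ x in Aᶜ, h x ∂ν| ≤ 1 - ∑ k ∈ Finset.range n, q k := by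
    rw [← hmass, ← probReal_compl_eq_one_sub hAm]
    simpa using norm_setIntegral_le_of_norm_le_const (μ := ν) (s := Aᶜ) (f := h) (C := 1)
      (measure_lt_top _ _) fun x _ => hb x
  have hpt : ∀ k ∈ Finset.range n, |(p k - q k) * h k| ≤ 2 * (p k * e k) - (p k - q k) := by
    intro k hk
    have h1 := he k hk
    have h2 : p k * (1 - e k) ≤ q k := hpe k hk
    rw [abs_mul]
    refine (mul_le_of_le_one_right (abs_nonneg _) (hb k)).trans (abs_le.2 ⟨?_, ?_⟩) <;> linarith
  have hsplit : ∑ k ∈ Finset.range n, p k * h k - ∫ x, h x ∂ν =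
      ∑ k ∈ Finset.range n, (p k - q k) * h k - ∫ x in Aᶜ, h x ∂ν := by
    rw [← integral_add_compl hAm hint, hin]
    simp only [sub_mul, Finset.sum_sub_distrib]
    ring
  rw [hsplit]
  have hS := (Finset.abs_sum_le_sum_abs _ _).trans (Finset.sum_le_sum hpt)
  rw [Finset.sum_sub_distrib, Finset.sum_sub_distrib, ← Finset.mul_sum, hp] at hS
  exact (abs_sub _ _).trans (by linarith)

theorem integral_comp_add_mul_sqrt_gaussianReal (l : ℕ) {h : ℝ → ℝ} (hm : Measurable h) :
    ∫ z, h ((l : ℝ) / 2 + z * Real.sqrt ((l : ℝ) / 4)) ∂(gaussianReal 0 1) =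
      ∫ x, h x ∂(gaussianReal (l / 2) (l / 4)) := by
  have hmap : gaussianReal (l / 2) (l / 4) = (gaussianReal 0 1).map
      (fun z => (l : ℝ) / 2 + z * Real.sqrt ((l : ℝ) / 4)) := by
    have hcomp := Measure.map_map (μ := gaussianReal 0 1)
      (measurable_const_add ((l : ℝ) / 2)) (measurable_mul_const (Real.sqrt ((l : ℝ) / 4)))
    rw [gaussianReal_map_mul_const, gaussianReal_map_const_add] at hcomp
    refine Eq.trans ?_ hcomp
    congr 1
    · ring
    · ext
      rw [NNReal.coe_mul, NNReal.coe_mk, Real.sq_sqrt (by positivity)]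
      simp
  rw [hmap, integral_map (by fun_prop) hm.aestronglyMeasurable]

/-- **Binomial versus Gaussian for lattice-constant test functions.**
There is a universal constant `C` such that for every `l ≥ 1`, every measurable
`h : ℝ → ℝ` with `|h| ≤ 1` which is constant on each interval `(z - 1/2, z + 1/2)`,
`z ∈ ℤ`, one has `|E[h(S)] - E[h(l/2 + Z √(l/4))]| ≤ C / l`, where `S ~ Bin(l, 1/2)`
and `Z ~ N(0,1)`. -/
theorem binomial_gaussian_lattice_bound :
    ∃ C : ℝ, ∀ l : ℕ, 1 ≤ l →
      ∀ h : ℝ → ℝ, Measurable h → (∀ x, |h x| ≤ 1) →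
      (∀ z : ℤ, ∀ x ∈ Set.Ioo ((z : ℝ) - 1 / 2) ((z : ℝ) + 1 / 2), h x = h z) →
      |(∑ k ∈ Finset.range (l + 1), (l.choose k : ℝ) / 2 ^ l * h k) -
          ∫ z, h ((l : ℝ) / 2 + z * Real.sqrt ((l : ℝ) / 4)) ∂(gaussianReal 0 1)|
        ≤ C / l := by
  refine ⟨6, fun l hl h hm hb hcell => ?_⟩
  have hl0 : l ≠ 0 := by omega
  have hv : (l : NNReal) / 4 ≠ 0 := by positivity
  have := nullSingletonClass_gaussianReal (μ := (l : ℝ) / 2) hv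
  rw [integral_comp_add_mul_sqrt_gaussianReal l hm]
  refine (abs_sum_mul_sub_integral_le (e := fun k : ℕ => 2 / l + (2 * k / l - 1) ^ 2) hm hb hcell
    (sum_choose_div_two_pow l) (fun k _ => by positivity) fun k hk =>
      choose_div_two_pow_mul_le_measureReal_Ioc hl0
        (Nat.lt_succ_iff.1 (Finset.mem_range.1 hk))).trans_eq ?_
  simp only [mul_add, Finset.sum_add_distrib]
  rw [← Finset.sum_mul, sum_choose_div_two_pow, sum_choose_div_two_pow_mul_sq hl0]
  ring
end
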